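/- arXiv:1410.6018 — 11 statements merged into one kernel-verified Lean document; each statement's English description precedes it below -/
import Mathlib

section
/- In the ring ℤ_p of p-adic integers, the series Σ_{α=0}^∞ k_α(i)·p^α converges and equals −i·m^{−1}, where m^{−1} is the inverse of m in ℤ_p; in other words, the integers k_α(i) ∈ {0, …, p−1} are exactly the p-adic digits of −i/m. -/
theorem mul_sum_mul_pow_eq_of_recurrence {R : Type*} [CommRing R] {q c : R} {r k : ℕ → R}
    (h : ∀ n, c * k n = q * r (n + 1) - r n) (n : ℕ) :
    c * ∑ α ∈ Finset.range n, k α * q ^ α = q ^ n * r n - r 0 := by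
  induction n with
  | zero => simp
  | succ n ih =>
    rw [Finset.sum_range_succ, mul_add, ih]
    linear_combination q ^ n * h n

theorem PadicInt.tendsto_pow_mul_zero (p : ℕ) [Fact p.Prime] (x : ℕ → ℤ_[p]) :
    Filter.Tendsto (fun n : ℕ => (p : ℤ_[p]) ^ n * x n) Filter.atTop (nhds 0) := by
  have hp : ‖(p : ℤ_[p])‖ < 1 := PadicInt.norm_lt_one_iff_dvd _ |>.2 dvd_rfl
  refine squeeze_zero_norm (fun n => ?_)
    (tendsto_pow_atTop_nhds_zero_of_lt_one (norm_nonneg (p : ℤ_[p])) hp)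
  rw [norm_mul, norm_pow]
  exact mul_le_of_le_one_right (by positivity) (PadicInt.norm_le_one _)


/-- In `ℤ_p`, the series `Σ_{α=0}^∞ k_α(i)·p^α` converges and equals
`−i·m⁻¹`, where `m⁻¹` is the inverse of `m` in `ℤ_p`; i.e. the digits `k_α(i)` are
exactly the p-adic digits of `−i/m`. -/
theorem stmt_3 (p : ℕ) [Fact p.Prime] (m i : ℕ) (hm : 1 < m) (hpm : ¬ p ∣ m)
    (hi : 0 < i) (him : i < m)
    (r : ℕ → ℕ) (hr : ∀ n : ℕ, r n < m ∧ (m : ℤ) ∣ (p : ℤ) ^ n * (r n : ℤ) - (i : ℤ))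
    (k : ℕ → ℤ) (hk : ∀ n : ℕ, (m : ℤ) * k n = (p : ℤ) * (r (n + 1) : ℤ) - (r n : ℤ))
    (hk' : ∀ n : ℕ, 0 ≤ k n ∧ k n ≤ (p : ℤ) - 1)
    (minv : ℤ_[p]) (hminv : (m : ℤ_[p]) * minv = 1) :
    Filter.Tendsto
      (fun n : ℕ => ∑ α ∈ Finset.range n, (k α : ℤ_[p]) * (p : ℤ_[p]) ^ α)
      Filter.atTop (nhds (-(i : ℤ_[p]) * minv)) := by
  have hr0 : r 0 = i := by
    obtain ⟨hlt, hdvd⟩ := hr 0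
    have hmod : i ≡ r 0 [MOD m] := Nat.modEq_iff_dvd.2 (by simpa using hdvd)
    exact (hmod.eq_of_lt_of_lt him hlt).symm
  have hk_cast (n : ℕ) :
      (m : ℤ_[p]) * (k n : ℤ_[p]) = (p : ℤ_[p]) * (r (n + 1) : ℤ_[p]) - (r n : ℤ_[p]) := by
    exact_mod_cast congrArg (Int.cast : ℤ → ℤ_[p]) (hk n)
  have hsum (n : ℕ) : ∑ α ∈ Finset.range n, (k α : ℤ_[p]) * (p : ℤ_[p]) ^ α =
      -(i : ℤ_[p]) * minv + (p : ℤ_[p]) ^ n * (r n * minv) := by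
    have h := mul_sum_mul_pow_eq_of_recurrence (r := fun n => (r n : ℤ_[p])) hk_cast n
    simp only [hr0] at h
    linear_combination minv * h -
      (∑ α ∈ Finset.range n, (k α : ℤ_[p]) * (p : ℤ_[p]) ^ α) * hminv
  simp_rw [hsum]
  simpa using (PadicInt.tendsto_pow_mul_zero p fun n => r n * minv).const_add
    (-(i : ℤ_[p]) * minv)
end

section
/- In the ring ℤ_p of p-adic integers, the element i·m^{−1} equals 1 + Σ_{α=0}^∞ (p − 1 − k_α(i))·p^α (a convergent series), where m^{−1} is the inverse of m in ℤ_p. -/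
/-- In `ℤ_p`, the element `i·m⁻¹` equals
`1 + Σ_{α=0}^∞ (p − 1 − k_α(i))·p^α` (a convergent series), where `m⁻¹` is the
inverse of `m` in `ℤ_p`. -/
theorem stmt_4 (p : ℕ) [Fact p.Prime] (m i : ℕ) (hm : 1 < m) (hpm : ¬ p ∣ m)
    (hi : 0 < i) (him : i < m)
    (r : ℕ → ℕ) (hr : ∀ n : ℕ, r n < m ∧ (m : ℤ) ∣ (p : ℤ) ^ n * (r n : ℤ) - (i : ℤ))
    (k : ℕ → ℤ) (hk : ∀ n : ℕ, (m : ℤ) * k n = (p : ℤ) * (r (n + 1) : ℤ) - (r n : ℤ))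
    (hk' : ∀ n : ℕ, 0 ≤ k n ∧ k n ≤ (p : ℤ) - 1)
    (minv : ℤ_[p]) (hminv : (m : ℤ_[p]) * minv = 1) :
    Filter.Tendsto
      (fun n : ℕ => 1 + ∑ α ∈ Finset.range n,
        (((p : ℤ) - 1 - k α : ℤ) : ℤ_[p]) * (p : ℤ_[p]) ^ α)
      Filter.atTop (nhds ((i : ℤ_[p]) * minv)) := by
  have hr0 : r 0 = i := by
    obtain ⟨h1, h2⟩ := hr 0
    rw [pow_zero, one_mul] at h2
    have h3 := Int.eq_zero_of_abs_lt_dvd h2 (by rw [abs_lt]; omega)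
    omega
  have hpartial : ∀ n : ℕ, 1 + ∑ α ∈ Finset.range n,
      (((p : ℤ) - 1 - k α : ℤ) : ℤ_[p]) * (p : ℤ_[p]) ^ α =
      (i : ℤ_[p]) * minv + (p : ℤ_[p]) ^ n * (1 - (r n : ℤ_[p]) * minv) := by
    intro n
    induction n with
    | zero => simp [hr0]
    | succ n ih =>
      have h : (m : ℤ_[p]) * (k n : ℤ_[p]) = p * (r (n + 1) : ℤ_[p]) - r n := by
        exact_mod_cast congrArg (Int.cast : ℤ → ℤ_[p]) (hk n)
      rw [Finset.sum_range_succ, ← add_assoc, ih]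
      push_cast
      linear_combination (-(p : ℤ_[p]) ^ n * minv) * h + (p : ℤ_[p]) ^ n * k n * hminv
  have hp : ‖(p : ℤ_[p])‖ < 1 := by
    rw [PadicInt.norm_p]
    exact inv_lt_one_of_one_lt₀ (by exact_mod_cast (Fact.out : p.Prime).one_lt)
  have hzero : Filter.Tendsto
      (fun n : ℕ => (p : ℤ_[p]) ^ n * (1 - (r n : ℤ_[p]) * minv)) Filter.atTop (nhds 0) := by
    refine squeeze_zero_norm (fun n => ?_)
      (tendsto_pow_atTop_nhds_zero_of_lt_one (norm_nonneg _) hp)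
    rw [norm_mul, norm_pow]
    exact mul_le_of_le_one_right (by positivity) (PadicInt.norm_le_one _)
  simp_rw [hpartial]
  simpa using hzero.const_add ((i : ℤ_[p]) * minv)
end

section
/- For every n ≥ 0 and every integer a with 0 ≤ a < p^n, one has Σ_{b=0}^{p−1} μ_{n+1}(a + b·p^n) = μ_n(a). (Hence the assignment a + p^nℤ_p ↦ μ_n(a) defines a ℤ_p-valued measure μ(i/m) on ℤ_p.) -/
/-- A partial sum `∑ α < n, d α * p ^ α` with digits `0 ≤ d α ≤ p - 1` lies in `[0, p ^ n - 1]`. -/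
theorem digit_sum_bounds (p : ℤ) (hp : 0 ≤ p) (d : ℕ → ℤ) (hd : ∀ n, 0 ≤ d n ∧ d n ≤ p - 1)
    (n : ℕ) :
    0 ≤ ∑ α ∈ Finset.range n, d α * p ^ α ∧ ∑ α ∈ Finset.range n, d α * p ^ α ≤ p ^ n - 1 := by
  induction n with
  | zero => simp
  | succ n ih =>
    rw [Finset.sum_range_succ, pow_succ]
    have hpn : 0 ≤ p ^ n := pow_nonneg hp n
    have h₀ := mul_nonneg (hd n).1 hpn
    have h₁ := mul_le_mul_of_nonneg_right (hd n).2 hpn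
    constructor <;> linarith [ih.1, ih.2]

/-- Comparison of `a + b * q` with `t + c * q` is lexicographic in `(b, a)` when `a < q` and
`1 ≤ t ≤ q`. -/
theorem add_mul_le_add_mul_iff {q t a b c : ℤ} (ha : 0 ≤ a) (haq : a < q) (ht : 1 ≤ t)
    (htq : t ≤ q) : t + c * q ≤ a + b * q ↔ c < b ∨ b = c ∧ t ≤ a := by
  rcases lt_trichotomy b c with h | rfl | h
  · have : (b + 1) * q ≤ c * q := mul_le_mul_of_nonneg_right h (by linarith)
    constructor
    · intro; linarith
    · omega
  · simp
  · have : (c + 1) * q ≤ b * q := mul_le_mul_of_nonneg_right h (by linarith)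
    exact ⟨fun _ => Or.inl h, fun _ => by linarith⟩


/-- For every `n ≥ 0` and every integer `a` with `0 ≤ a < p^n`, one has
`Σ_{b=0}^{p−1} μ_{n+1}(a + b·p^n) = μ_n(a)`, where
`μ_n(a) := r_n·m⁻¹ + δ_n(a) ∈ ℤ_p`, `δ_n(a) = −1` if `a ≥ T_n` and `0` otherwise,
`T_n = 1 + Σ_{α<n} (p−1−k_α(i))·p^α`.  (Hence `a + p^nℤ_p ↦ μ_n(a)` defines a
`ℤ_p`-valued measure `μ(i/m)` on `ℤ_p`.) -/
theorem stmt_6 (p : ℕ) [Fact p.Prime] (m i : ℕ) (hm : 1 < m) (hpm : ¬ p ∣ m)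
    (hi : 0 < i) (him : i < m)
    (r : ℕ → ℕ) (hr : ∀ n : ℕ, r n < m ∧ (m : ℤ) ∣ (p : ℤ) ^ n * (r n : ℤ) - (i : ℤ))
    (k : ℕ → ℤ) (hk : ∀ n : ℕ, (m : ℤ) * k n = (p : ℤ) * (r (n + 1) : ℤ) - (r n : ℤ))
    (hk' : ∀ n : ℕ, 0 ≤ k n ∧ k n ≤ (p : ℤ) - 1)
    (minv : ℤ_[p]) (hminv : (m : ℤ_[p]) * minv = 1)
    (T : ℕ → ℤ)
    (hT : ∀ n : ℕ, T n = 1 + ∑ α ∈ Finset.range n, ((p : ℤ) - 1 - k α) * (p : ℤ) ^ α)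
    (δ : ℕ → ℕ → ℤ) (hδ : ∀ n a : ℕ, δ n a = if T n ≤ (a : ℤ) then -1 else 0)
    (μ : ℕ → ℕ → ℤ_[p])
    (hμ : ∀ n a : ℕ, μ n a = (r n : ℤ_[p]) * minv + (δ n a : ℤ_[p])) :
    ∀ n : ℕ, ∀ a : ℕ, a < p ^ n →
      ∑ b ∈ Finset.range p, μ (n + 1) (a + b * p ^ n) = μ n a := by
  intro n a ha
  have hT_bounds := digit_sum_bounds p (Int.natCast_nonneg p) (fun α => (p : ℤ) - 1 - k α)
    (fun α => ⟨by linarith [(hk' α).2], by linarith [(hk' α).1]⟩) n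
  obtain ⟨c, hc⟩ : ∃ c : ℕ, (c : ℤ) = (p : ℤ) - 1 - k n :=
    ⟨((p : ℤ) - 1 - k n).toNat, Int.toNat_of_nonneg (by linarith [(hk' n).2])⟩
  have hcp : c < p := by have := (hk' n).1; omega
  have hT_succ : T (n + 1) = T n + c * (p : ℤ) ^ n := by
    rw [hT, hT, Finset.sum_range_succ, hc]; ring
  have hδ_succ (b : ℕ) : δ (n + 1) (a + b * p ^ n) =
      (if c < b then -1 else 0) + if b = c then δ n a else 0 := by
    have h := add_mul_le_add_mul_iff (q := (p : ℤ) ^ n) (t := T n) (a := a) (b := b) (c := c)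
      (by positivity) (mod_cast ha) (by linarith [hT n, hT_bounds.1])
      (by linarith [hT n, hT_bounds.2])
    rw [hδ, hδ, hT_succ]
    push_cast
    simp only [h, Nat.cast_lt, Nat.cast_inj]
    split_ifs <;> first | rfl | omega
  have hcard : ((Finset.range p).filter (c < ·)).card = p - 1 - c := by
    rw [show (Finset.range p).filter (c < ·) = Finset.Ioo c p by ext; simp [and_comm],
      Nat.card_Ioo]
    omega
  have hδ_sum : ∑ b ∈ Finset.range p, δ (n + 1) (a + b * p ^ n) = -k n + δ n a := by
    simp only [hδ_succ, Finset.sum_add_distrib, Finset.sum_ite_eq', Finset.mem_range, hcp, if_true]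
    rw [← Finset.sum_filter, Finset.sum_const, hcard, nsmul_eq_mul]
    have : ((p - 1 - c : ℕ) : ℤ) = k n := by omega
    rw [this]; ring
  have hk_cast : (m : ℤ_[p]) * (k n : ℤ_[p]) = p * r (n + 1) - r n := mod_cast
    congrArg (Int.cast : ℤ → ℤ_[p]) (hk n)
  simp only [hμ, Finset.sum_add_distrib, Finset.sum_const, Finset.card_range, nsmul_eq_mul]
  rw [← Int.cast_sum, hδ_sum]
  push_cast
  linear_combination -minv * hk_cast + (k n : ℤ_[p]) * hminv
end

section
/- For every integer k ≥ 1, the sequence n ↦ Σ_{α=0}^{p^n−1} α^{k−1}·μ_n(α) converges in ℚ_p to (1/k)·(B_k(i/m) − B_k). -/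
/-- The power-sum polynomial over `ℚ`, whose value at `n` is `∑ a < n, a ^ j`. -/
noncomputable def powerSumPoly (j : ℕ) : Polynomial ℚ :=
  Polynomial.C (1 / ((j + 1 : ℕ) : ℚ)) *
    (Polynomial.bernoulli (j + 1) - Polynomial.C (bernoulli (j + 1)))

theorem powerSumPoly_eval (j : ℕ) (x : ℚ) :
    (powerSumPoly j).eval x =
      1 / ((j + 1 : ℕ) : ℚ) * ((Polynomial.bernoulli (j + 1)).eval x - bernoulli (j + 1)) := by
  simp [powerSumPoly]

theorem powerSumPoly_eval_natCast (j n : ℕ) :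
    (powerSumPoly j).eval (n : ℚ) = ∑ a ∈ Finset.range n, (a : ℚ) ^ j := by
  have h := Polynomial.sum_range_pow_eq_bernoulli_sub n j
  rw [powerSumPoly_eval, ← Nat.succ_eq_add_one, ← h]
  have : (j : ℚ) + 1 ≠ 0 := by positivity
  push_cast
  field_simp

theorem powerSumPoly_aeval_ratCast {F : Type*} [Field F] [CharZero F] (j : ℕ) (x : ℚ) :
    Polynomial.aeval (x : F) (powerSumPoly j) = (((powerSumPoly j).eval x : ℚ) : F) := by
  have h := Polynomial.aeval_algebraMap_apply F x (powerSumPoly j)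
  simpa using h

theorem powerSumPoly_aeval_natCast {F : Type*} [Field F] [CharZero F] (j n : ℕ) :
    Polynomial.aeval (n : F) (powerSumPoly j) = ∑ a ∈ Finset.range n, (a : F) ^ j := by
  have h := powerSumPoly_aeval_ratCast (F := F) j n
  rw [powerSumPoly_eval_natCast] at h
  simpa using h

/-- A sum over `range N` weighted by `-1` from `t` on is a difference of two initial sums. -/
theorem sum_range_mul_ite_neg_one {R : Type*} [CommRing R] (f : ℕ → R) {t N : ℕ} (h : t ≤ N) :
    ∑ a ∈ Finset.range N, f a * (if t ≤ a then -1 else 0) =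
      ∑ a ∈ Finset.range t, f a - ∑ a ∈ Finset.range N, f a := by
  have h₁ : ∑ a ∈ Finset.range t, f a * (if t ≤ a then (-1 : R) else 0) = 0 :=
    Finset.sum_eq_zero fun a ha => by
      rw [if_neg (not_le.2 (Finset.mem_range.1 ha)), mul_zero]
  have h₂ : ∑ a ∈ Finset.Ico t N, f a * (if t ≤ a then (-1 : R) else 0) =
      -∑ a ∈ Finset.Ico t N, f a := by
    rw [← Finset.sum_neg_distrib]
    exact Finset.sum_congr rfl fun a ha => by rw [if_pos (Finset.mem_Ico.1 ha).1]; ring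
  rw [← Finset.sum_range_add_sum_Ico _ h, h₁, h₂, ← Finset.sum_range_add_sum_Ico f h]
  ring

/-- For every integer `k ≥ 1`, the sequence
`n ↦ Σ_{α=0}^{p^n−1} α^{k−1}·μ_n(α)` converges in `ℚ_p` to
`(1/k)·(B_k(i/m) − B_k)`. -/
theorem stmt_8 (p : ℕ) [Fact p.Prime] (m i : ℕ) (hm : 1 < m) (hpm : ¬ p ∣ m)
    (hi : 0 < i) (him : i < m)
    (r : ℕ → ℕ) (hr : ∀ n : ℕ, r n < m ∧ (m : ℤ) ∣ (p : ℤ) ^ n * (r n : ℤ) - (i : ℤ))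
    (k : ℕ → ℤ) (hk : ∀ n : ℕ, (m : ℤ) * k n = (p : ℤ) * (r (n + 1) : ℤ) - (r n : ℤ))
    (hk' : ∀ n : ℕ, 0 ≤ k n ∧ k n ≤ (p : ℤ) - 1)
    (minv : ℤ_[p]) (hminv : (m : ℤ_[p]) * minv = 1)
    (T : ℕ → ℤ)
    (hT : ∀ n : ℕ, T n = 1 + ∑ α ∈ Finset.range n, ((p : ℤ) - 1 - k α) * (p : ℤ) ^ α)
    (δ : ℕ → ℕ → ℤ) (hδ : ∀ n a : ℕ, δ n a = if T n ≤ (a : ℤ) then -1 else 0)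
    (μ : ℕ → ℕ → ℤ_[p])
    (hμ : ∀ n a : ℕ, μ n a = (r n : ℤ_[p]) * minv + (δ n a : ℤ_[p])) :
    ∀ K : ℕ, 1 ≤ K →
      Filter.Tendsto
        (fun n : ℕ => ∑ α ∈ Finset.range (p ^ n),
          (α : ℚ_[p]) ^ (K - 1) * (μ n α : ℚ_[p]))
        Filter.atTop
        (nhds ((((1 / (K : ℚ)) *
          (Polynomial.eval ((i : ℚ) / (m : ℚ)) (Polynomial.bernoulli K)
            - bernoulli K) : ℚ) : ℚ_[p]))) := by
  have hm0 : (m : ℤ) ≠ 0 := by omega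
  have hr0 : r 0 = i := by
    obtain ⟨h₁, h₂⟩ := hr 0
    rw [pow_zero, one_mul] at h₂
    have := Int.eq_zero_of_abs_lt_dvd h₂ (abs_lt.2 ⟨by omega, by omega⟩)
    omega
  have hksum (n : ℕ) :
      (m : ℤ) * ∑ α ∈ Finset.range n, k α * (p : ℤ) ^ α = (p : ℤ) ^ n * r n - i := by
    induction n with
    | zero => simp [hr0]
    | succ n ih =>
      rw [Finset.sum_range_succ, mul_add, ih]
      linear_combination (p : ℤ) ^ n * hk n
  have hTsum (n : ℕ) : T n = (p : ℤ) ^ n - ∑ α ∈ Finset.range n, k α * (p : ℤ) ^ α := by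
    rw [hT]
    induction n with
    | zero => simp
    | succ n ih =>
      rw [Finset.sum_range_succ, Finset.sum_range_succ]
      linear_combination ih
  have hT0 (n : ℕ) : 0 ≤ T n := by
    rw [hT]
    have : 0 ≤ ∑ α ∈ Finset.range n, ((p : ℤ) - 1 - k α) * (p : ℤ) ^ α :=
      Finset.sum_nonneg fun α _ => mul_nonneg (by linarith [(hk' α).2]) (by positivity)
    omega
  have hTle (n : ℕ) : T n ≤ (p : ℤ) ^ n := by
    rw [hTsum]
    have : 0 ≤ ∑ α ∈ Finset.range n, k α * (p : ℤ) ^ α :=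
      Finset.sum_nonneg fun α _ => mul_nonneg (hk' α).1 (by positivity)
    omega
  choose t ht using fun n => Int.eq_ofNat_of_zero_le (hT0 n)
  have htle (n : ℕ) : t n ≤ p ^ n := by
    have := hTle n
    rw [ht] at this
    exact_mod_cast this
  have hmp : (m : ℚ_[p]) ≠ 0 := by
    exact_mod_cast hm0
  have hminv' : (minv : ℚ_[p]) = (m : ℚ_[p])⁻¹ := by
    have : (m : ℚ_[p]) * minv = 1 := by exact_mod_cast congrArg (Subtype.val) hminv
    exact eq_inv_of_mul_eq_one_right this
  have htcast (n : ℕ) : (t n : ℚ_[p]) =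
      i / m + (p : ℚ_[p]) ^ n * (((1 - r n * minv : ℤ_[p])) : ℚ_[p]) := by
    have h : (m : ℤ) * t n = m * (p : ℤ) ^ n - ((p : ℤ) ^ n * r n - i) := by
      rw [← hksum, ← ht, hTsum]
      ring
    have h' : (m : ℚ_[p]) * t n = m * (p : ℚ_[p]) ^ n - ((p : ℚ_[p]) ^ n * r n - i) := by
      exact_mod_cast congrArg (Int.cast : ℤ → ℚ_[p]) h
    push_cast
    rw [hminv']
    field_simp
    linear_combination h'
  have hpow : Filter.Tendsto (fun n : ℕ => (p : ℚ_[p]) ^ n) Filter.atTop (nhds 0) :=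
    tendsto_pow_atTop_nhds_zero_of_norm_lt_one Padic.norm_p_lt_one
  have hbdd (x : ℕ → ℤ_[p]) : Filter.IsBoundedUnder (· ≤ ·) Filter.atTop
      (norm ∘ fun n => (x n : ℚ_[p])) :=
    Filter.isBoundedUnder_of ⟨1, fun n => PadicInt.norm_le_one (x n)⟩
  have httend : Filter.Tendsto (fun n => (t n : ℚ_[p])) Filter.atTop
      (nhds ((((i : ℚ) / m : ℚ)) : ℚ_[p])) := by
    simp_rw [htcast]
    simpa using tendsto_const_nhds.add
      (hpow.zero_mul_isBoundedUnder_le (hbdd fun n => 1 - r n * minv))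
  intro K hK
  obtain ⟨j, rfl⟩ := Nat.exists_eq_add_of_le' hK
  rw [← powerSumPoly_eval, ← powerSumPoly_aeval_ratCast]
  have hcont := (powerSumPoly j).continuous_aeval (A := ℚ_[p])
  have hP0 : Polynomial.aeval (0 : ℚ_[p]) (powerSumPoly j) = 0 := by
    simpa using powerSumPoly_aeval_natCast (F := ℚ_[p]) j 0
  have hlim₁ := (hcont.tendsto _).comp httend
  have hlim₂ := (hcont.tendsto _).comp hpow
  rw [hP0] at hlim₂
  have hlim := hlim₁.sub
    (hlim₂.zero_mul_isBoundedUnder_le (hbdd fun n => 1 - r n * minv))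
  rw [sub_zero] at hlim
  refine hlim.congr fun n => ?_
  have hδ' (a : ℕ) : ((δ n a : ℤ) : ℚ_[p]) = if t n ≤ a then -1 else 0 := by
    rw [hδ, ht]
    simp
  have hP := powerSumPoly_aeval_natCast (F := ℚ_[p]) j (p ^ n)
  rw [Nat.cast_pow] at hP
  simp only [Function.comp_apply, powerSumPoly_aeval_natCast, hP, hμ, Nat.add_sub_cancel]
  push_cast
  simp_rw [hδ', mul_add, Finset.sum_add_distrib, ← Finset.sum_mul]
  rw [sum_range_mul_ite_neg_one _ (htle n)]
  ring
end

section
/- For every integer k ≥ 1, the sequence n ↦ Σ_{0 ≤ α < p^n, p ∤ α} α^{k−1}·μ_n(α) converges in ℚ_p to (1/k)·(B_k(i/m) − B_k) − (p^{k−1}/k)·(B_k(r_1/m) − B_k). -/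
/-- The threshold `1 + ∑_{α < n} (p - 1 - k α) p ^ α` attached to a digit sequence `k`. -/
def digitThreshold (p : ℕ) (k : ℕ → ℤ) (n : ℕ) : ℤ :=
  1 + ∑ α ∈ Finset.range n, ((p : ℤ) - 1 - k α) * (p : ℤ) ^ α

lemma one_le_digitThreshold (p : ℕ) (k : ℕ → ℤ) (hk : ∀ n, k n ≤ (p : ℤ) - 1) (n : ℕ) :
    1 ≤ digitThreshold p k n := by
  have : 0 ≤ ∑ α ∈ Finset.range n, ((p : ℤ) - 1 - k α) * (p : ℤ) ^ α :=
    Finset.sum_nonneg fun α _ => mul_nonneg (by linarith [hk α]) (by positivity)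
  unfold digitThreshold
  linarith

lemma digitThreshold_le_pow (p : ℕ) (k : ℕ → ℤ) (hk : ∀ n, 0 ≤ k n) (n : ℕ) :
    digitThreshold p k n ≤ (p : ℤ) ^ n := by
  induction n with
  | zero => simp [digitThreshold]
  | succ n ih =>
    have h : 0 ≤ k n * (p : ℤ) ^ n := mul_nonneg (hk n) (by positivity)
    unfold digitThreshold at ih ⊢
    rw [Finset.sum_range_succ, pow_succ]
    linarith

lemma digitThreshold_succ (p : ℕ) (k : ℕ → ℤ) (n : ℕ) :
    digitThreshold p k (n + 1) =
      p * (digitThreshold p (fun j => k (j + 1)) n - 1) + (p - k 0) := by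
  unfold digitThreshold
  rw [Finset.sum_range_succ', add_sub_cancel_left, Finset.mul_sum]
  have : ∀ α ∈ Finset.range n, ((p : ℤ) - 1 - k (α + 1)) * (p : ℤ) ^ (α + 1) =
      p * (((p : ℤ) - 1 - k (α + 1)) * (p : ℤ) ^ α) := fun α _ => by ring
  rw [Finset.sum_congr rfl this]
  ring

lemma digitThreshold_succ_le_mul_iff (p : ℕ) (k : ℕ → ℤ) (h0 : 0 ≤ k 0) (h1 : k 0 ≤ (p : ℤ) - 1)
    (n : ℕ) (b : ℤ) :
    digitThreshold p k (n + 1) ≤ p * b ↔ digitThreshold p (fun j => k (j + 1)) n ≤ b := by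
  rw [digitThreshold_succ]
  set t := digitThreshold p (fun j => k (j + 1)) n
  constructor
  · intro h
    by_contra! hb
    have : (p : ℤ) * b ≤ p * (t - 1) := mul_le_mul_of_nonneg_left (by linarith) (by linarith)
    linarith
  · intro h
    have : (p : ℤ) * t ≤ p * b := mul_le_mul_of_nonneg_left h (by linarith)
    linarith

lemma mul_digitThreshold (p m : ℕ) (r : ℕ → ℕ) (k : ℕ → ℤ)
    (hk : ∀ n : ℕ, (m : ℤ) * k n = (p : ℤ) * (r (n + 1) : ℤ) - (r n : ℤ)) (n : ℕ) :
    (m : ℤ) * digitThreshold p k n = r 0 + (p : ℤ) ^ n * (m - r n) := by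
  induction n with
  | zero => simp [digitThreshold]
  | succ n ih =>
    unfold digitThreshold at ih ⊢
    rw [Finset.sum_range_succ, pow_succ]
    linear_combination ih - (p : ℤ) ^ n * hk n

/-- Faulhaber's formula, in terms of Bernoulli polynomials, over a field of characteristic zero. -/
lemma sum_range_pow_eq_aeval_bernoulli {F : Type*} [Field F] [CharZero F] (N K : ℕ) (hK : 1 ≤ K) :
    ∑ a ∈ Finset.range N, (a : F) ^ (K - 1) =
      (Polynomial.aeval (N : F) (Polynomial.bernoulli K) - (bernoulli K : ℚ)) / K := by
  obtain ⟨q, rfl⟩ : ∃ q, K = q + 1 := ⟨K - 1, by omega⟩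
  have h := congrArg (fun x : ℚ => (x : F)) (Polynomial.sum_range_pow_eq_bernoulli_sub N q)
  have h2 : ((Polynomial.eval (N : ℚ) (Polynomial.bernoulli (q + 1)) : ℚ) : F) =
      Polynomial.aeval (N : F) (Polynomial.bernoulli (q + 1)) := by
    have := Polynomial.aeval_algebraMap_apply F (N : ℚ) (Polynomial.bernoulli (q + 1))
    simpa using this.symm
  have hq : ((q + 1 : ℕ) : F) ≠ 0 := by exact_mod_cast Nat.succ_ne_zero q
  rw [eq_div_iff hq, ← h2]
  push_cast at h ⊢
  rw [mul_comm]
  exact h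

lemma sum_pow_mul_measure_eq {F : Type*} [Field F] [CharZero F] (N t K : ℕ) (hK : 1 ≤ K)
    (ht : t ≤ N) (c : F) :
    ∑ a ∈ Finset.range N, (a : F) ^ (K - 1) * (c + if t ≤ a then -1 else 0) =
      c * ((Polynomial.aeval (N : F) (Polynomial.bernoulli K) - (bernoulli K : ℚ)) / K) -
        (Polynomial.aeval (N : F) (Polynomial.bernoulli K) -
          Polynomial.aeval (t : F) (Polynomial.bernoulli K)) / K := by
  have hN := sum_range_pow_eq_aeval_bernoulli (F := F) N K hK
  have hT := sum_range_pow_eq_aeval_bernoulli (F := F) t K hK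
  have h3 : ∑ a ∈ Finset.range N, (a : F) ^ (K - 1) * (if t ≤ a then -1 else 0) =
      ∑ a ∈ Finset.range t, (a : F) ^ (K - 1) - ∑ a ∈ Finset.range N, (a : F) ^ (K - 1) := by
    rw [← Finset.sum_range_add_sum_Ico (fun a => (a : F) ^ (K - 1)) ht,
      ← Finset.sum_range_add_sum_Ico _ ht]
    have e1 : ∑ a ∈ Finset.range t, (a : F) ^ (K - 1) * (if t ≤ a then -1 else 0) = 0 :=
      Finset.sum_eq_zero fun a ha => by
        rw [if_neg (by simpa using ha), mul_zero]
    have e2 : ∑ a ∈ Finset.Ico t N, (a : F) ^ (K - 1) * (if t ≤ a then -1 else 0) =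
        -∑ a ∈ Finset.Ico t N, (a : F) ^ (K - 1) := by
      rw [← Finset.sum_neg_distrib]
      exact Finset.sum_congr rfl fun a ha => by
        rw [if_pos (Finset.mem_Ico.1 ha).1, mul_neg_one]
    rw [e1, e2]
    ring
  simp_rw [mul_add]
  rw [Finset.sum_add_distrib, h3, ← Finset.sum_mul, hN, hT]
  ring

/-- The moments `∫ x ^ (K - 1) dμ` over all of `ℤ_p`. -/
lemma tendsto_sum_pow_mul_measure (p : ℕ) [Fact p.Prime] (m : ℕ) (hm : m ≠ 0) (r : ℕ → ℕ)
    (k : ℕ → ℤ) (hk : ∀ n : ℕ, (m : ℤ) * k n = (p : ℤ) * (r (n + 1) : ℤ) - (r n : ℤ))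
    (hk' : ∀ n : ℕ, 0 ≤ k n ∧ k n ≤ (p : ℤ) - 1) (K : ℕ) (hK : 1 ≤ K) :
    Filter.Tendsto
      (fun n : ℕ => ∑ a ∈ Finset.range (p ^ n), (a : ℚ_[p]) ^ (K - 1) *
        ((r n : ℚ_[p]) / m + if digitThreshold p k n ≤ (a : ℤ) then -1 else 0))
      Filter.atTop
      (nhds ((((1 / (K : ℚ)) * (Polynomial.eval ((r 0 : ℚ) / (m : ℚ)) (Polynomial.bernoulli K)
        - bernoulli K) : ℚ) : ℚ_[p]))) := by
  have hmQ : (m : ℚ_[p]) ≠ 0 := by exact_mod_cast hm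
  set A : ℚ_[p] → ℚ_[p] := fun x => Polynomial.aeval x (Polynomial.bernoulli K) with hA
  have hAc : Continuous A := Polynomial.continuous_aeval _
  have hcast (q : ℚ) : ((Polynomial.eval q (Polynomial.bernoulli K) : ℚ) : ℚ_[p]) = A q := by
    have := Polynomial.aeval_algebraMap_apply ℚ_[p] q (Polynomial.bernoulli K)
    simpa using this.symm
  have hpow : Filter.Tendsto (fun n : ℕ => ((p : ℚ_[p])) ^ n) Filter.atTop (nhds 0) :=
    tendsto_pow_atTop_nhds_zero_of_norm_lt_one Padic.norm_p_lt_one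
  have hbdd {u v : ℕ → ℚ_[p]} (hu : Filter.Tendsto u Filter.atTop (nhds 0)) (C : ℝ)
      (hv : ∀ n, ‖v n‖ ≤ C) : Filter.Tendsto (fun n => v n * u n) Filter.atTop (nhds 0) := by
    refine squeeze_zero_norm (a := fun n => C * ‖u n‖) (fun n => ?_) ?_
    · rw [norm_mul]
      exact mul_le_mul_of_nonneg_right (hv n) (norm_nonneg _)
    · simpa using (hu.norm.const_mul C)
  have hrnorm (n : ℕ) : ‖(r n : ℚ_[p]) / m‖ ≤ 1 / ‖(m : ℚ_[p])‖ := by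
    rw [norm_div]
    gcongr
    exact_mod_cast Padic.norm_int_le_one (p := p) (r n)
  have hval : ∀ n, (digitThreshold p k n : ℚ_[p]) =
      (r 0 : ℚ_[p]) / m + ((p : ℚ_[p]) ^ n - (r n : ℚ_[p]) / m * (p : ℚ_[p]) ^ n) := by
    intro n
    have h := congrArg (fun z : ℤ => (z : ℚ_[p])) (mul_digitThreshold p m r k hk n)
    push_cast at h
    field_simp
    linear_combination h
  have hT : Filter.Tendsto (fun n => (digitThreshold p k n : ℚ_[p])) Filter.atTop
      (nhds ((r 0 : ℚ_[p]) / m)) := by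
    simp_rw [hval]
    simpa using (hpow.sub (hbdd hpow _ hrnorm)).const_add ((r 0 : ℚ_[p]) / m)
  have hA0 : A 0 = (bernoulli K : ℚ) := by
    simpa using (hcast 0).symm
  have hAp : Filter.Tendsto (fun n : ℕ => A ((p : ℚ_[p]) ^ n)) Filter.atTop
      (nhds ((bernoulli K : ℚ) : ℚ_[p])) := by
    rw [← hA0]
    exact (hAc.tendsto 0).comp hpow
  have hAT := (hAc.tendsto ((r 0 : ℚ_[p]) / m)).comp hT
  have hz : Filter.Tendsto (fun n : ℕ => (A ((p : ℚ_[p]) ^ n) - (bernoulli K : ℚ)) / K)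
      Filter.atTop (nhds 0) := by
    simpa using (hAp.sub_const ((bernoulli K : ℚ) : ℚ_[p])).div_const (K : ℚ_[p])
  have hlim := (hbdd hz _ hrnorm).sub ((hAp.sub hAT).div_const (K : ℚ_[p]))
  convert hlim using 1
  · funext n
    have h1 := one_le_digitThreshold p k (fun n => (hk' n).2) n
    have h2 := digitThreshold_le_pow p k (fun n => (hk' n).1) n
    obtain ⟨t, ht⟩ := Int.eq_ofNat_of_zero_le (zero_le_one.trans h1)
    have htp : t ≤ p ^ n := by rw [ht] at h2; exact_mod_cast h2
    have h := sum_pow_mul_measure_eq (p ^ n) t K hK htp ((r n : ℚ_[p]) / m)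
    simp only [Function.comp, ht, hA]
    push_cast at h ⊢
    simpa using h
  · congr 1
    push_cast
    rw [hcast]
    push_cast
    ring

lemma sum_filter_dvd_range_pow_succ {M : Type*} [AddCommMonoid M] (p : ℕ) (hp : 0 < p) (n : ℕ)
    (f : ℕ → M) :
    ∑ a ∈ (Finset.range (p ^ (n + 1))).filter (fun a => p ∣ a), f a =
      ∑ b ∈ Finset.range (p ^ n), f (p * b) := by
  symm
  refine Finset.sum_bij (fun b _ => p * b) ?_ ?_ ?_ ?_
  · intro b hb
    rw [Finset.mem_range] at hb
    rw [Finset.mem_filter, Finset.mem_range, pow_succ']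
    exact ⟨Nat.mul_lt_mul_of_pos_left hb hp, dvd_mul_right _ _⟩
  · intro a _ b _ h
    exact Nat.eq_of_mul_eq_mul_left hp h
  · intro a ha
    rw [Finset.mem_filter, Finset.mem_range, pow_succ'] at ha
    obtain ⟨h, b, rfl⟩ := ha
    exact ⟨b, Finset.mem_range.2 (Nat.lt_of_mul_lt_mul_left h), rfl⟩
  · intro _ _
    rfl


/-- For every integer `k ≥ 1`, the sequence
`n ↦ Σ_{0 ≤ α < p^n, p ∤ α} α^{k−1}·μ_n(α)` converges in `ℚ_p` to
`(1/k)·(B_k(i/m) − B_k) − (p^{k−1}/k)·(B_k(r_1/m) − B_k)`. -/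
theorem stmt_9 (p : ℕ) [Fact p.Prime] (m i : ℕ) (hm : 1 < m) (hpm : ¬ p ∣ m)
    (hi : 0 < i) (him : i < m)
    (r : ℕ → ℕ) (hr : ∀ n : ℕ, r n < m ∧ (m : ℤ) ∣ (p : ℤ) ^ n * (r n : ℤ) - (i : ℤ))
    (k : ℕ → ℤ) (hk : ∀ n : ℕ, (m : ℤ) * k n = (p : ℤ) * (r (n + 1) : ℤ) - (r n : ℤ))
    (hk' : ∀ n : ℕ, 0 ≤ k n ∧ k n ≤ (p : ℤ) - 1)
    (minv : ℤ_[p]) (hminv : (m : ℤ_[p]) * minv = 1)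
    (T : ℕ → ℤ)
    (hT : ∀ n : ℕ, T n = 1 + ∑ α ∈ Finset.range n, ((p : ℤ) - 1 - k α) * (p : ℤ) ^ α)
    (δ : ℕ → ℕ → ℤ) (hδ : ∀ n a : ℕ, δ n a = if T n ≤ (a : ℤ) then -1 else 0)
    (μ : ℕ → ℕ → ℤ_[p])
    (hμ : ∀ n a : ℕ, μ n a = (r n : ℤ_[p]) * minv + (δ n a : ℤ_[p])) :
    ∀ K : ℕ, 1 ≤ K →
      Filter.Tendsto
        (fun n : ℕ => ∑ α ∈ (Finset.range (p ^ n)).filter (fun α => ¬ p ∣ α),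
          (α : ℚ_[p]) ^ (K - 1) * (μ n α : ℚ_[p]))
        Filter.atTop
        (nhds ((((1 / (K : ℚ)) *
            (Polynomial.eval ((i : ℚ) / (m : ℚ)) (Polynomial.bernoulli K)
              - bernoulli K)
          - ((p : ℚ) ^ (K - 1) / (K : ℚ)) *
            (Polynomial.eval ((r 1 : ℚ) / (m : ℚ)) (Polynomial.bernoulli K)
              - bernoulli K) : ℚ) : ℚ_[p]))) := by
  intro K hK
  have hp : 0 < p := (Fact.out : p.Prime).pos
  have hr0 : r 0 = i := by
    obtain ⟨h1, h2⟩ := hr 0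
    rw [pow_zero, one_mul] at h2
    have h3 := Int.eq_zero_of_abs_lt_dvd h2 (by rw [abs_lt]; omega)
    omega
  have hm0 : m ≠ 0 := by omega
  have hminv' : (minv : ℚ_[p]) = (m : ℚ_[p])⁻¹ := by
    refine eq_inv_of_mul_eq_one_right ?_
    exact_mod_cast congrArg (fun x : ℤ_[p] => (x : ℚ_[p])) hminv
  have hμ' : ∀ n a : ℕ, ((μ n a : ℤ_[p]) : ℚ_[p]) =
      (r n : ℚ_[p]) / m + if digitThreshold p k n ≤ (a : ℤ) then -1 else 0 := by
    intro n a
    have hTn : T n = digitThreshold p k n := hT n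
    rw [hμ, hδ, hTn]
    push_cast
    rw [hminv', div_eq_mul_inv]
    split_ifs <;> simp
  have hfull := tendsto_sum_pow_mul_measure p m hm0 r k hk hk' K hK
  have hshift := tendsto_sum_pow_mul_measure p m hm0 (fun n => r (n + 1)) (fun n => k (n + 1))
    (fun n => hk (n + 1)) (fun n => hk' (n + 1)) K hK
  rw [← Filter.tendsto_add_atTop_iff_nat 1] at hfull ⊢
  convert hfull.sub (hshift.const_mul ((p : ℚ_[p]) ^ (K - 1))) using 1
  · funext n
    simp_rw [hμ']
    rw [eq_sub_iff_add_eq, ← Finset.sum_filter_add_sum_filter_not (Finset.range (p ^ (n + 1)))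
      (fun a => p ∣ a), sum_filter_dvd_range_pow_succ p hp, add_comm, Finset.mul_sum]
    congr 1
    refine Finset.sum_congr rfl fun b _ => ?_
    have hiff := digitThreshold_succ_le_mul_iff p k (hk' 0).1 (hk' 0).2 n b
    push_cast
    simp only [hiff]
    ring
  · rw [hr0]
    congr 1
    push_cast
    ring
end

section
/- Fix n ≥ 1. Let V be the unique integer in [0, p^{n+1}) congruent to i·m^{−1} modulo p^{n+1} in ℤ_p, let β_0 := V mod p, and let W be the unique integer in [0, p^n) congruent to r_1·m^{−1} modulo p^n in ℤ_p. If β_0 = 0 then W = V/p, and if β_0 ≠ 0 then W ≡ 1 + (V − β_0)/p (mod p^n). -/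
/-- If `a` is congruent to `b / m` modulo `p ^ n` in `ℤ_[p]`, then `m * a` is congruent to `b`
modulo `p ^ n` in `ℤ`. -/
theorem intCast_pow_dvd_of_dvd_sub_mul_inv {p : ℕ} [Fact p.Prime] {m a b n : ℕ} {u : ℤ_[p]}
    (hu : (m : ℤ_[p]) * u = 1) (h : (p : ℤ_[p]) ^ n ∣ (a : ℤ_[p]) - (b : ℤ_[p]) * u) :
    (p : ℤ) ^ n ∣ m * a - b := by
  have key := PadicInt.pow_p_dvd_int_iff (p := p) n (m * a - b)
  refine key.1 ?_
  have heq : (((m * a - b : ℤ)) : ℤ_[p]) = m * (a - b * u) := by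
    push_cast
    linear_combination (b : ℤ_[p]) * hu
  rw [heq]
  exact h.mul_left _

/-- Fix `n ≥ 1`. Let `V` be the unique integer in `[0, p^{n+1})`
congruent to `i·m⁻¹` modulo `p^{n+1}` in `ℤ_p`, let `β₀ := V mod p`, and let `W` be
the unique integer in `[0, p^n)` congruent to `r_1·m⁻¹` modulo `p^n` in `ℤ_p`.
If `β₀ = 0` then `W = V/p`, and if `β₀ ≠ 0` then `W ≡ 1 + (V − β₀)/p (mod p^n)`. -/
theorem stmt_10 (p : ℕ) [Fact p.Prime] (m i : ℕ) (hm : 1 < m) (hpm : ¬ p ∣ m)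
    (hi : 0 < i) (him : i < m)
    (r : ℕ → ℕ) (hr : ∀ n : ℕ, r n < m ∧ (m : ℤ) ∣ (p : ℤ) ^ n * (r n : ℤ) - (i : ℤ))
    (minv : ℤ_[p]) (hminv : (m : ℤ_[p]) * minv = 1)
    (n : ℕ) (hn : 1 ≤ n)
    (V : ℕ) (hV1 : V < p ^ (n + 1))
    (hV2 : (p : ℤ_[p]) ^ (n + 1) ∣ (V : ℤ_[p]) - (i : ℤ_[p]) * minv)
    (W : ℕ) (hW1 : W < p ^ n)
    (hW2 : (p : ℤ_[p]) ^ n ∣ (W : ℤ_[p]) - (r 1 : ℤ_[p]) * minv) :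
    (V % p = 0 → W = V / p) ∧
      (V % p ≠ 0 →
        (W : ℤ) ≡ 1 + ((V : ℤ) - ((V % p : ℕ) : ℤ)) / (p : ℤ) [ZMOD (p : ℤ) ^ n]) := by
  have hp : p.Prime := Fact.out
  have hp0 : (0 : ℤ) < p := by exact_mod_cast hp.pos
  have hm0 : (0 : ℤ) < m := by exact_mod_cast hm.trans' one_pos
  have hV : (p : ℤ) ^ (n + 1) ∣ m * V - i := intCast_pow_dvd_of_dvd_sub_mul_inv hminv hV2
  have hW : (p : ℤ) ^ n ∣ m * W - r 1 := intCast_pow_dvd_of_dvd_sub_mul_inv hminv hW2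
  obtain ⟨hr1, k, hk⟩ := hr 1
  rw [pow_one] at hk
  have hk0 : 0 ≤ k := by
    have : (0 : ℤ) ≤ p * r 1 := by positivity
    by_contra! h
    nlinarith
  have hkp : k < p := by
    by_contra! h
    nlinarith
  have hdvd : (p : ℤ) ^ (n + 1) ∣ V - p * W + k := by
    have hcop : IsCoprime ((p : ℤ) ^ (n + 1)) m :=
      (Nat.isCoprime_iff_coprime.2 ((Nat.Prime.coprime_iff_not_dvd hp).2 hpm)).pow_left
    refine hcop.dvd_of_dvd_mul_left ?_
    have h : (p : ℤ) ^ (n + 1) ∣ p * (m * W - r 1) := by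
      rw [pow_succ']
      exact mul_dvd_mul_left _ hW
    have heq : (m : ℤ) * (V - p * W + k) = (m * V - i) - p * (m * W - r 1) := by
      linear_combination -hk
    rw [heq]
    exact dvd_sub hV h
  have hdiv : (V : ℤ) = p * (V / p : ℕ) + (V % p : ℕ) := by
    exact_mod_cast (Nat.div_add_mod V p).symm
  have hb : ((V % p : ℕ) : ℤ) < p := by exact_mod_cast Nat.mod_lt V hp.pos
  generalize V % p = b at *
  have hq : V / p < p ^ n := Nat.div_lt_of_lt_mul (by rwa [← pow_succ'])
  generalize V / p = q at *
  obtain ⟨c, hc⟩ : (p : ℤ) ∣ b + k := by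
    obtain ⟨d, hd⟩ := (dvd_pow_self (p : ℤ) n.succ_ne_zero).trans hdvd
    exact ⟨d - q + W, by linear_combination hd - hdiv⟩
  have hqW : (p : ℤ) ^ n ∣ q - W + c := by
    refine Int.dvd_of_mul_dvd_mul_left hp0.ne' ?_
    rw [← pow_succ']
    convert hdvd using 1
    linear_combination -hdiv - hc
  constructor
  · rintro rfl
    have hc0 : c = 0 := by
      push_cast at hc
      have h1 : c < 1 := by nlinarith
      have h2 : -1 < c := by nlinarith
      omega
    rw [hc0, add_zero] at hqW
    refine Nat.ModEq.eq_of_lt_of_lt (m := p ^ n) ?_ hW1 hq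
    exact (Nat.modEq_iff_dvd).2 (by exact_mod_cast hqW)
  · intro hb0
    have hbpos : (0 : ℤ) < b := by exact_mod_cast Nat.pos_of_ne_zero hb0
    have hc1 : c = 1 := by
      have h1 : c < 2 := by nlinarith
      have h2 : 0 < c := by nlinarith
      omega
    rw [hdiv, add_sub_cancel_right, Int.mul_ediv_cancel_left _ hp0.ne', Int.modEq_iff_dvd]
    convert hqW using 1
    rw [hc1]
    ring
end

section
/- Let c be a unit of ℤ_p. For every integer k ≥ 1, the sequence n ↦ Σ_{α=0}^{p^n−1} α^{k−1}·μ_{c,n}(α) converges in ℚ_p to (1 − c^k)·(1/k)·(B_k(i/m) − B_k). -/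
/-- Faulhaber's formula over a `ℚ`-algebra that is a field. -/
theorem sum_range_pow_eq_bernoulli_aeval {F : Type*} [Field F] [CharZero F] (j N : ℕ) :
    ∑ a ∈ Finset.range N, (a : F) ^ j =
      ((j + 1 : ℕ) : F)⁻¹ *
        (Polynomial.aeval (N : F) (Polynomial.bernoulli (j + 1)) - (bernoulli (j + 1) : ℚ)) := by
  have h := congrArg (fun q : ℚ => (q : F)) (Polynomial.sum_range_pow_eq_bernoulli_sub N j)
  have e : Polynomial.aeval (N : F) (Polynomial.bernoulli (j + 1)) =
      ((Polynomial.eval (N : ℚ) (Polynomial.bernoulli (j + 1)) : ℚ) : F) := by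
    have := Polynomial.aeval_algebraMap_apply F (N : ℚ) (Polynomial.bernoulli (j + 1))
    simpa using this
  have hj : ((j + 1 : ℕ) : F) ≠ 0 := Nat.cast_ne_zero.mpr j.succ_ne_zero
  rw [e, eq_inv_mul_iff_mul_eq₀ hj]
  push_cast at h ⊢
  exact h

/-- A system of division by `c` modulo `p ^ n` permutes the residues `0, …, p ^ n - 1`. -/
theorem sum_range_comp_of_dvd_mul_sub {p : ℕ} [Fact p.Prime] {M : Type*} [AddCommMonoid M]
    (n : ℕ) (c : ℤ_[p]) (b : ℕ → ℕ)
    (hb : ∀ a, b a < p ^ n ∧ (p : ℤ_[p]) ^ n ∣ c * (b a : ℤ_[p]) - (a : ℤ_[p])) (f : ℕ → M) :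
    ∑ a ∈ Finset.range (p ^ n), f (b a) = ∑ a ∈ Finset.range (p ^ n), f a := by
  have hinj : Set.InjOn b (Finset.range (p ^ n) : Set ℕ) := by
    intro x hx y hy hxy
    have hd := dvd_sub (hb y).2 (hb x).2
    rw [hxy, sub_sub_sub_cancel_left] at hd
    have hd' : (p : ℤ_[p]) ^ n ∣ (((x : ℤ) - (y : ℤ) : ℤ) : ℤ_[p]) := by
      push_cast
      exact hd
    rw [PadicInt.pow_p_dvd_int_iff] at hd'
    have hmod : y ≡ x [MOD p ^ n] := (Nat.modEq_iff_dvd).2 (by push_cast; exact hd')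
    exact (hmod.eq_of_lt_of_lt (by simpa using hy) (by simpa using hx)).symm
  have himg : (Finset.range (p ^ n)).image b = Finset.range (p ^ n) := by
    refine Finset.eq_of_subset_of_card_le ?_ (Finset.card_image_of_injOn hinj).ge
    intro x hx
    obtain ⟨a, -, rfl⟩ := Finset.mem_image.1 hx
    exact Finset.mem_range.2 (hb a).1
  conv_rhs => rw [← himg]
  rw [Finset.sum_image hinj]

/-- Replacing `x` by `c * b x` in a moment changes it by a multiple of `p ^ n`. -/
theorem pow_dvd_sum_pow_mul_sub {p : ℕ} [Fact p.Prime] (n j : ℕ) (c : ℤ_[p]) (b : ℕ → ℕ)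
    (hb : ∀ a, b a < p ^ n ∧ (p : ℤ_[p]) ^ n ∣ c * (b a : ℤ_[p]) - (a : ℤ_[p]))
    (μ : ℕ → ℤ_[p]) :
    (p : ℤ_[p]) ^ n ∣ c ^ j * ∑ a ∈ Finset.range (p ^ n), (a : ℤ_[p]) ^ j * μ a -
      ∑ a ∈ Finset.range (p ^ n), (a : ℤ_[p]) ^ j * μ (b a) := by
  rw [← sum_range_comp_of_dvd_mul_sub n c b hb (fun a => (a : ℤ_[p]) ^ j * μ a), Finset.mul_sum,
    ← Finset.sum_sub_distrib]
  refine Finset.dvd_sum fun a _ => ?_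
  rw [← mul_assoc, ← mul_pow, ← sub_mul]
  exact ((hb a).2.trans (sub_dvd_pow_sub_pow _ _ j)).mul_right _

/-- Summing against a measure which is a constant minus the indicator of `[t, N)`. -/
theorem sum_range_mul_add_ite {R : Type*} [CommRing R] (g : ℕ → R) (s : R) {t N : ℕ} (ht : t ≤ N) :
    ∑ a ∈ Finset.range N, g a * (s + ((if (t : ℤ) ≤ (a : ℤ) then -1 else 0 : ℤ) : R)) =
      s * ∑ a ∈ Finset.range N, g a -
        (∑ a ∈ Finset.range N, g a - ∑ a ∈ Finset.range t, g a) := by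
  rw [← Finset.sum_range_add_sum_Ico (fun a => g a *
      (s + ((if (t : ℤ) ≤ (a : ℤ) then -1 else 0 : ℤ) : R))) ht,
    ← Finset.sum_range_add_sum_Ico g ht,
    Finset.sum_congr rfl (g := fun a => g a * s),
    Finset.sum_congr (s₁ := Finset.Ico t N) rfl (g := fun a => g a * s - g a),
    Finset.sum_sub_distrib, ← Finset.sum_mul, ← Finset.sum_mul]
  · ring
  · intro a ha
    rw [if_pos (by exact_mod_cast (Finset.mem_Ico.1 ha).1)]
    push_cast
    ring
  · intro a ha
    rw [if_neg (by have := Finset.mem_range.1 ha; omega)]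
    simp

/-- Let `c` be a unit of `ℤ_p`. For every integer `k ≥ 1`, the sequence
`n ↦ Σ_{α=0}^{p^n−1} α^{k−1}·μ_{c,n}(α)` converges in `ℚ_p` to
`(1 − c^k)·(1/k)·(B_k(i/m) − B_k)`, where `μ_{c,n}(a) := μ_n(a) − c·μ_n(b)` with `b`
the unique integer in `[0, p^n)` congruent to `c⁻¹·a` modulo `p^n`. -/
theorem stmt_11 (p : ℕ) [Fact p.Prime] (m i : ℕ) (hm : 1 < m) (hpm : ¬ p ∣ m)
    (hi : 0 < i) (him : i < m)
    (r : ℕ → ℕ) (hr : ∀ n : ℕ, r n < m ∧ (m : ℤ) ∣ (p : ℤ) ^ n * (r n : ℤ) - (i : ℤ))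
    (k : ℕ → ℤ) (hk : ∀ n : ℕ, (m : ℤ) * k n = (p : ℤ) * (r (n + 1) : ℤ) - (r n : ℤ))
    (hk' : ∀ n : ℕ, 0 ≤ k n ∧ k n ≤ (p : ℤ) - 1)
    (minv : ℤ_[p]) (hminv : (m : ℤ_[p]) * minv = 1)
    (T : ℕ → ℤ)
    (hT : ∀ n : ℕ, T n = 1 + ∑ α ∈ Finset.range n, ((p : ℤ) - 1 - k α) * (p : ℤ) ^ α)
    (δ : ℕ → ℕ → ℤ) (hδ : ∀ n a : ℕ, δ n a = if T n ≤ (a : ℤ) then -1 else 0)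
    (μ : ℕ → ℕ → ℤ_[p])
    (hμ : ∀ n a : ℕ, μ n a = (r n : ℤ_[p]) * minv + (δ n a : ℤ_[p]))
    (c : ℤ_[p]ˣ)
    (b : ℕ → ℕ → ℕ)
    (hb : ∀ n a : ℕ, b n a < p ^ n ∧
      (p : ℤ_[p]) ^ n ∣ (c : ℤ_[p]) * (b n a : ℤ_[p]) - (a : ℤ_[p]))
    (μc : ℕ → ℕ → ℤ_[p])
    (hμc : ∀ n a : ℕ, μc n a = μ n a - (c : ℤ_[p]) * μ n (b n a)) :
    ∀ K : ℕ, 1 ≤ K →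
      Filter.Tendsto
        (fun n : ℕ => ∑ α ∈ Finset.range (p ^ n),
          (α : ℚ_[p]) ^ (K - 1) * (μc n α : ℚ_[p]))
        Filter.atTop
        (nhds ((1 - ((c : ℤ_[p]) : ℚ_[p]) ^ K) *
          (((1 / (K : ℚ)) *
            (Polynomial.eval ((i : ℚ) / (m : ℚ)) (Polynomial.bernoulli K)
              - bernoulli K) : ℚ) : ℚ_[p]))) := by
  intro K hK
  obtain ⟨j, rfl⟩ : ∃ j, K = j + 1 := ⟨K - 1, by omega⟩
  have hm0 : (m : ℤ) ≠ 0 := by omega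
  have hmQ : (m : ℚ_[p]) ≠ 0 := by exact_mod_cast hm0
  have hminv' : (minv : ℚ_[p]) = (m : ℚ_[p])⁻¹ := by
    have h := congrArg (fun x : ℤ_[p] => (x : ℚ_[p])) hminv
    push_cast at h
    exact eq_inv_of_mul_eq_one_right h
  have hr0 : r 0 = i := by
    obtain ⟨h1, h2⟩ := hr 0
    have hmod : i ≡ r 0 [MOD m] := (Nat.modEq_iff_dvd).2 (by simpa using h2)
    exact (hmod.eq_of_lt_of_lt him h1).symm
  have hgeom : ∀ n, (m : ℤ) * T n = m * (p : ℤ) ^ n + i - (p : ℤ) ^ n * r n := by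
    intro n
    induction n with
    | zero => simp [hT, hr0]
    | succ n ih =>
      have h : T (n + 1) = T n + ((p : ℤ) - 1 - k n) * (p : ℤ) ^ n := by
        rw [hT, hT, Finset.sum_range_succ, add_assoc]
      rw [h, pow_succ]
      linear_combination ih - (p : ℤ) ^ n * hk n
  have hT1 : ∀ n, 1 ≤ T n ∧ T n ≤ (p : ℤ) ^ n := by
    intro n
    induction n with
    | zero => simp [hT]
    | succ n ih =>
      have h : T (n + 1) = T n + ((p : ℤ) - 1 - k n) * (p : ℤ) ^ n := by
        rw [hT, hT, Finset.sum_range_succ, add_assoc]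
      have hp : (0 : ℤ) ≤ (p : ℤ) ^ n := by positivity
      obtain ⟨h1, h2⟩ := hk' n
      rw [h, pow_succ]
      constructor <;> nlinarith [mul_nonneg h1 hp, mul_nonneg (sub_nonneg.2 h2) hp]
  set G : ℚ_[p] → ℚ_[p] := fun x => ((j + 1 : ℕ) : ℚ_[p])⁻¹ *
    (Polynomial.aeval x (Polynomial.bernoulli (j + 1)) - (bernoulli (j + 1) : ℚ)) with hG
  have hGc : Continuous G := by
    have := Polynomial.continuous_aeval (A := ℚ_[p]) (Polynomial.bernoulli (j + 1))
    fun_prop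
  have hGsum : ∀ N : ℕ, ∑ a ∈ Finset.range N, (a : ℚ_[p]) ^ j = G N := fun N =>
    sum_range_pow_eq_bernoulli_aeval j N
  have hG0 : G 0 = 0 := by simpa using (hGsum 0).symm
  have hlim : (((1 / ((j + 1 : ℕ) : ℚ)) *
      (Polynomial.eval ((i : ℚ) / (m : ℚ)) (Polynomial.bernoulli (j + 1))
        - bernoulli (j + 1)) : ℚ) : ℚ_[p]) = G ((i : ℚ_[p]) / m) := by
    have h := Polynomial.aeval_algebraMap_apply ℚ_[p] ((i : ℚ) / m) (Polynomial.bernoulli (j + 1))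
    simp only [eq_ratCast, Polynomial.coe_aeval_eq_eval, Rat.cast_div, Rat.cast_natCast] at h
    simp only [hG]
    rw [h]
    push_cast
    ring
  have hpow : Filter.Tendsto (fun n : ℕ => (p : ℚ_[p]) ^ n) Filter.atTop (nhds 0) :=
    tendsto_pow_atTop_nhds_zero_of_norm_lt_one Padic.norm_p_lt_one
  have hzero : ∀ u : ℕ → ℤ_[p], ∀ v : ℕ → ℚ_[p], Filter.Tendsto v Filter.atTop (nhds 0) →
      Filter.Tendsto (fun n => (u n : ℚ_[p]) * v n) Filter.atTop (nhds 0) := by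
    intro u v hv
    refine squeeze_zero_norm (fun n => ?_) (by simpa using hv.norm)
    rw [norm_mul]
    exact mul_le_of_le_one_left (norm_nonneg _) (u n).2
  have hTlim : Filter.Tendsto (fun n => (T n : ℚ_[p])) Filter.atTop
      (nhds ((i : ℚ_[p]) / m)) := by
    have h := (hpow.add_const ((i : ℚ_[p]) / m)).sub
      (hzero (fun n => (r n : ℤ_[p]) * minv) _ hpow)
    rw [zero_add, sub_zero] at h
    refine h.congr fun n => ?_
    have e := congrArg (fun x : ℤ => (x : ℚ_[p])) (hgeom n)
    push_cast at e ⊢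
    rw [hminv']
    field_simp
    linear_combination -e
  set S : ℕ → ℤ_[p] := fun n => ∑ a ∈ Finset.range (p ^ n), (a : ℤ_[p]) ^ j * μ n a with hS
  have hSeq : ∀ n, (S n : ℚ_[p]) =
      (((r n : ℤ_[p]) * minv : ℤ_[p]) : ℚ_[p]) * G ((p : ℚ_[p]) ^ n) -
        (G ((p : ℚ_[p]) ^ n) - G (T n)) := by
    intro n
    obtain ⟨t, ht⟩ := Int.eq_ofNat_of_zero_le (zero_le_one.trans (hT1 n).1)
    have htN : t ≤ p ^ n := by
      have := (hT1 n).2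
      rw [ht] at this
      exact_mod_cast this
    have h := sum_range_mul_add_ite (fun a : ℕ => (a : ℤ_[p]) ^ j) ((r n : ℤ_[p]) * minv) htN
    have hS' : S n = (r n : ℤ_[p]) * minv * ∑ a ∈ Finset.range (p ^ n), (a : ℤ_[p]) ^ j -
        (∑ a ∈ Finset.range (p ^ n), (a : ℤ_[p]) ^ j -
          ∑ a ∈ Finset.range t, (a : ℤ_[p]) ^ j) := by
      simp only [hS, hμ, hδ, ht]
      exact h
    rw [hS', ht]
    push_cast
    simp only [PadicInt.coe_sum, PadicInt.coe_pow, PadicInt.coe_natCast, hGsum]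
    push_cast
    rfl
  have hSlim : Filter.Tendsto (fun n => (S n : ℚ_[p])) Filter.atTop
      (nhds (G ((i : ℚ_[p]) / m))) := by
    have h1 : Filter.Tendsto (fun n : ℕ => G ((p : ℚ_[p]) ^ n)) Filter.atTop (nhds 0) := by
      have := (hGc.tendsto 0).comp hpow
      rwa [hG0] at this
    have h2 := (hGc.tendsto _).comp hTlim
    have h := (hzero (fun n => (r n : ℤ_[p]) * minv) _ h1).sub (h1.sub h2)
    simp only [zero_sub, neg_neg] at h
    exact h.congr fun n => (hSeq n).symm
  choose w hw using fun n => pow_dvd_sum_pow_mul_sub n j (c : ℤ_[p]) (b n) (hb n) (μ n)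
  have hfin := (hSlim.const_mul (1 - ((c : ℤ_[p]) : ℚ_[p]) ^ (j + 1))).add
    (hzero (fun n => (c : ℤ_[p]) * w n) _ hpow)
  rw [hlim]
  rw [add_zero] at hfin
  refine hfin.congr fun n => ?_
  have hsum : ∑ a ∈ Finset.range (p ^ n), (a : ℤ_[p]) ^ j * μc n a =
      (1 - (c : ℤ_[p]) ^ (j + 1)) * S n + (c : ℤ_[p]) * w n * (p : ℤ_[p]) ^ n := by
    have h : ∑ a ∈ Finset.range (p ^ n), (a : ℤ_[p]) ^ j * μc n a = S n -
        (c : ℤ_[p]) * ∑ a ∈ Finset.range (p ^ n), (a : ℤ_[p]) ^ j * μ n (b n a) := by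
      rw [hS, Finset.mul_sum, ← Finset.sum_sub_distrib]
      refine Finset.sum_congr rfl fun a _ => ?_
      rw [hμc]
      ring
    rw [h]
    linear_combination (c : ℤ_[p]) * hw n
  have e := congrArg (fun x : ℤ_[p] => (x : ℚ_[p])) hsum
  rw [PadicInt.coe_sum] at e
  push_cast at e
  rw [Nat.add_sub_cancel, e]
  push_cast
  rfl
end

section
/- Let c be a unit of ℤ_p. For every integer k ≥ 1, the sequence n ↦ Σ_{0 ≤ α < p^n, p ∤ α} α^{k−1}·μ_{c,n}(α) converges in ℚ_p to (1 − c^k)·[(1/k)·(B_k(i/m) − B_k) − (p^{k−1}/k)·(B_k(r_1/m) − B_k)]. -/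
open Finset Filter Topology in
/-- Faulhaber's formula in `ℚ_[p]`. -/
theorem padic_sum_range_pow (p : ℕ) [Fact p.Prime] (K N : ℕ) :
    ∑ a ∈ range N, (a : ℚ_[p]) ^ K =
      (((Polynomial.bernoulli (K + 1)).map (algebraMap ℚ ℚ_[p])).eval (N : ℚ_[p])
        - (bernoulli (K + 1) : ℚ)) / ((K : ℚ_[p]) + 1) := by
  have h := Polynomial.sum_range_pow_eq_bernoulli_sub N K
  have h0 : ((K : ℚ_[p]) + 1) ≠ 0 := by exact_mod_cast Nat.succ_ne_zero K
  have h2 := congrArg (algebraMap ℚ ℚ_[p]) h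
  rw [eq_div_iff h0, mul_comm]
  simp only [map_mul, map_sub, map_sum, map_pow, map_add, map_natCast, map_one,
    eq_ratCast, Nat.succ_eq_add_one] at h2
  rw [h2, ← eq_ratCast (algebraMap ℚ ℚ_[p]) (Polynomial.eval _ _),
    ← Polynomial.eval_map_apply, map_natCast]

/-- The thresholds of the measure attached to a digit sequence, in closed form. -/
theorem threshold_mul_eq (p m : ℕ) (r : ℕ → ℕ) (k T : ℕ → ℤ)
    (hk : ∀ n : ℕ, (m : ℤ) * k n = (p : ℤ) * (r (n + 1) : ℤ) - (r n : ℤ))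
    (hT : ∀ n : ℕ, T n = 1 + ∑ α ∈ Finset.range n, ((p : ℤ) - 1 - k α) * (p : ℤ) ^ α) (n : ℕ) :
    (m : ℤ) * T n = m * (p : ℤ) ^ n + r 0 - (p : ℤ) ^ n * r n := by
  induction n with
  | zero => simp [hT]
  | succ n ih =>
    rw [hT, Finset.sum_range_succ, ← add_assoc, ← hT, mul_add, ih]
    linear_combination (-(p : ℤ) ^ n) * hk n

theorem threshold_mem (p : ℕ) (k T : ℕ → ℤ)
    (hk' : ∀ n : ℕ, 0 ≤ k n ∧ k n ≤ (p : ℤ) - 1)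
    (hT : ∀ n : ℕ, T n = 1 + ∑ α ∈ Finset.range n, ((p : ℤ) - 1 - k α) * (p : ℤ) ^ α) (n : ℕ) :
    0 ≤ T n ∧ T n ≤ (p : ℤ) ^ n := by
  induction n with
  | zero => simp [hT]
  | succ n ih =>
    rw [hT, Finset.sum_range_succ, ← add_assoc, ← hT]
    have hp : (0 : ℤ) ≤ (p : ℤ) ^ n := by positivity
    have h1 := mul_nonneg (sub_nonneg.2 (hk' n).2) hp
    have h2 := mul_nonneg (hk' n).1 hp
    rw [pow_succ]
    constructor <;> nlinarith

open Finset Filter Topology in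
theorem tendsto_natCast_mul_pow_zero (p : ℕ) [Fact p.Prime] (r : ℕ → ℕ) :
    Tendsto (fun n => (r n : ℚ_[p]) * (p : ℚ_[p]) ^ n) atTop (𝓝 0) := by
  have h : Tendsto (fun n => (p : ℚ_[p]) ^ n) atTop (𝓝 0) :=
    tendsto_pow_atTop_nhds_zero_of_norm_lt_one Padic.norm_p_lt_one
  refine squeeze_zero_norm (fun n => ?_) (tendsto_zero_iff_norm_tendsto_zero.1 h)
  rw [norm_mul]
  exact mul_le_of_le_one_left (norm_nonneg _) (by exact_mod_cast Padic.norm_int_le_one (r n : ℤ))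

theorem sum_range_mul_threshold {R : Type*} [CommRing R] (f : ℕ → R) (N t : ℕ) (ht : t ≤ N) (x : R) :
    ∑ a ∈ Finset.range N, f a * (x + if t ≤ a then -1 else 0) =
      x * ∑ a ∈ Finset.range N, f a
        - (∑ a ∈ Finset.range N, f a - ∑ a ∈ Finset.range t, f a) := by
  induction N, ht using Nat.le_induction with
  | base =>
    rw [sub_self, sub_zero, Finset.mul_sum]
    refine Finset.sum_congr rfl fun a ha => ?_
    rw [if_neg (by simpa using ha)]
    ring
  | succ N hN ih =>
    rw [Finset.sum_range_succ, ih, Finset.sum_range_succ f N, if_pos hN]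
    ring

open Finset Filter Topology in
/-- The moments of the measure attached to a digit sequence. -/
theorem tendsto_moment (p : ℕ) [Fact p.Prime] (m : ℕ) (hm : m ≠ 0)
    (r : ℕ → ℕ) (k T : ℕ → ℤ)
    (hk : ∀ n : ℕ, (m : ℤ) * k n = (p : ℤ) * (r (n + 1) : ℤ) - (r n : ℤ))
    (hk' : ∀ n : ℕ, 0 ≤ k n ∧ k n ≤ (p : ℤ) - 1)
    (hT : ∀ n : ℕ, T n = 1 + ∑ α ∈ Finset.range n, ((p : ℤ) - 1 - k α) * (p : ℤ) ^ α) (K : ℕ) :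
    Tendsto (fun n => ∑ a ∈ range (p ^ n), (a : ℚ_[p]) ^ K *
        ((r n : ℚ_[p]) / m + if T n ≤ (a : ℤ) then -1 else 0)) atTop
      (𝓝 ((1 / ((K : ℚ) + 1) * ((Polynomial.bernoulli (K + 1)).eval ((r 0 : ℚ) / m)
        - bernoulli (K + 1)) : ℚ) : ℚ_[p])) := by
  set P := (Polynomial.bernoulli (K + 1)).map (algebraMap ℚ ℚ_[p]) with hP
  have hm0 : (m : ℚ_[p]) ≠ 0 := by exact_mod_cast hm
  have h0 : ((K : ℚ_[p]) + 1) ≠ 0 := by exact_mod_cast Nat.succ_ne_zero K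
  have hB : P.eval 0 = (bernoulli (K + 1) : ℚ) := by
    rw [← map_zero (algebraMap ℚ ℚ_[p]), hP, Polynomial.eval_map_apply,
      Polynomial.bernoulli_eval_zero, eq_ratCast]
  have hpow : Tendsto (fun n => (p : ℚ_[p]) ^ n) atTop (𝓝 0) :=
    tendsto_pow_atTop_nhds_zero_of_norm_lt_one Padic.norm_p_lt_one
  have hPp : Tendsto (fun n => P.eval ((p : ℚ_[p]) ^ n)) atTop
      (𝓝 ((bernoulli (K + 1) : ℚ) : ℚ_[p])) := by
    rw [← hB]
    exact (P.continuous.tendsto 0).comp hpow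
  have hTeq (n : ℕ) : (T n : ℚ_[p]) =
      (r 0 : ℚ_[p]) / m + (p : ℚ_[p]) ^ n - (r n : ℚ_[p]) * (p : ℚ_[p]) ^ n / m := by
    have := congrArg (Int.cast : ℤ → ℚ_[p]) (threshold_mul_eq p m r k T hk hT n)
    push_cast at this
    field_simp
    linear_combination this
  have hTt : Tendsto (fun n => (T n : ℚ_[p])) atTop (𝓝 ((r 0 : ℚ_[p]) / m)) := by
    simp only [hTeq]
    simpa using (tendsto_const_nhds.add hpow).sub
      ((tendsto_natCast_mul_pow_zero p r).div_const (m : ℚ_[p]))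
  have hPT := (P.continuous.tendsto ((r 0 : ℚ_[p]) / m)).comp hTt
  have hsum : Tendsto (fun n => (r n : ℚ_[p]) / m *
      ((P.eval ((p : ℚ_[p]) ^ n) - (bernoulli (K + 1) : ℚ)) / ((K : ℚ_[p]) + 1))) atTop (𝓝 0) := by
    have hz : Tendsto (fun n => (P.eval ((p : ℚ_[p]) ^ n) - (bernoulli (K + 1) : ℚ)) /
        (m : ℚ_[p]) / ((K : ℚ_[p]) + 1)) atTop (𝓝 0) := by
      simpa using ((hPp.sub_const ((bernoulli (K + 1) : ℚ) : ℚ_[p])).div_const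
        (m : ℚ_[p])).div_const ((K : ℚ_[p]) + 1)
    refine squeeze_zero_norm (fun n => ?_) (tendsto_zero_iff_norm_tendsto_zero.1 hz)
    rw [show ∀ x y z w : ℚ_[p], x / y * (z / w) = x * (z / y / w) by intros; ring, norm_mul]
    exact mul_le_of_le_one_left (norm_nonneg _)
      (by exact_mod_cast Padic.norm_int_le_one (r n : ℤ))
  have hlim := hsum.sub ((hPp.sub hPT).div_const ((K : ℚ_[p]) + 1))
  convert hlim using 1
  · funext n
    obtain ⟨hT0, hTn⟩ := threshold_mem p k T hk' hT n
    obtain ⟨t, ht⟩ := Int.eq_ofNat_of_zero_le hT0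
    have htn : t ≤ p ^ n := by exact_mod_cast ht ▸ hTn
    have := sum_range_mul_threshold (fun a => (a : ℚ_[p]) ^ K) (p ^ n) t htn ((r n : ℚ_[p]) / m)
    simp only [ht, Nat.cast_le, Function.comp_apply, Int.cast_natCast]
    rw [this, padic_sum_range_pow, padic_sum_range_pow, ← hP]
    push_cast
    ring
  · congr 1
    have : P.eval ((r 0 : ℚ_[p]) / m) =
        (((Polynomial.bernoulli (K + 1)).eval ((r 0 : ℚ) / m) : ℚ) : ℚ_[p]) := by
      rw [← eq_ratCast (algebraMap ℚ ℚ_[p]) (Polynomial.eval _ _),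
        ← Polynomial.eval_map_apply, map_div₀, map_natCast, map_natCast]
    rw [this]
    push_cast
    ring

theorem sum_range_pow_filter_not_dvd {M : Type*} [AddCommGroup M] (p : ℕ) (hp : 0 < p) (n : ℕ)
    (f : ℕ → M) :
    ∑ a ∈ (Finset.range (p ^ (n + 1))).filter (fun a => ¬ p ∣ a), f a =
      ∑ a ∈ Finset.range (p ^ (n + 1)), f a - ∑ a ∈ Finset.range (p ^ n), f (p * a) := by
  rw [← Finset.sum_filter_add_sum_filter_not (Finset.range (p ^ (n + 1))) (fun a => p ∣ a) f,
    eq_sub_iff_add_eq, add_comm]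
  congr 1
  refine Finset.sum_nbij (fun a => p * a) ?_ ?_ ?_ (fun _ _ => rfl)
  · intro a ha
    simp only [Finset.mem_range, Finset.mem_filter] at ha ⊢
    exact ⟨by rw [pow_succ']; gcongr, dvd_mul_right _ _⟩
  · intro a _ a' _ h
    exact Nat.eq_of_mul_eq_mul_left hp h
  · intro a ha
    simp only [Finset.coe_filter, Finset.mem_range, Set.mem_ofPred_eq] at ha
    obtain ⟨h1, d, rfl⟩ := ha
    rw [pow_succ'] at h1
    exact ⟨d, by simpa using Nat.lt_of_mul_lt_mul_left h1, rfl⟩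

/-- The threshold of the shifted digit sequence cuts out the multiples of `p`. -/
theorem threshold_succ_le_mul (p : ℕ) (k T : ℕ → ℤ)
    (hk' : ∀ n : ℕ, 0 ≤ k n ∧ k n ≤ (p : ℤ) - 1)
    (hT : ∀ n : ℕ, T n = 1 + ∑ α ∈ Finset.range n, ((p : ℤ) - 1 - k α) * (p : ℤ) ^ α)
    (n : ℕ) (a : ℤ) :
    T (n + 1) ≤ p * a ↔
      1 + ∑ α ∈ Finset.range n, ((p : ℤ) - 1 - k (α + 1)) * (p : ℤ) ^ α ≤ a := by
  have h : T (n + 1) = 1 + ((p : ℤ) - 1 - k 0) +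
      p * ∑ α ∈ Finset.range n, ((p : ℤ) - 1 - k (α + 1)) * (p : ℤ) ^ α := by
    rw [hT, Finset.sum_range_succ', Finset.mul_sum]
    simp only [pow_succ]
    rw [pow_zero, mul_one, add_comm (Finset.sum _ _), ← add_assoc]
    congr 1
    exact Finset.sum_congr rfl fun _ _ => by ring
  rw [h]
  generalize ∑ α ∈ Finset.range n, ((p : ℤ) - 1 - k (α + 1)) * (p : ℤ) ^ α = s
  obtain ⟨h0, h1⟩ := hk' 0
  constructor
  · intro hle
    by_contra! hlt
    nlinarith
  · intro hle
    nlinarith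

open Finset Filter Topology in
/-- Twisting a family of values by a unit multiplies its moments over units by a power of the
unit, up to an error divisible by `p ^ n`. -/
theorem dvd_sum_twist_sub (p : ℕ) [Fact p.Prime] (c : ℤ_[p]ˣ) (n : ℕ) (b : ℕ → ℕ)
    (hb : ∀ a : ℕ, b a < p ^ (n + 1) ∧
      (p : ℤ_[p]) ^ (n + 1) ∣ (c : ℤ_[p]) * (b a : ℤ_[p]) - (a : ℤ_[p]))
    (ν : ℕ → ℤ_[p]) (K : ℕ) :
    (p : ℤ_[p]) ^ (n + 1) ∣
      ∑ α ∈ (range (p ^ (n + 1))).filter (fun α => ¬ p ∣ α),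
        (α : ℤ_[p]) ^ K * (ν α - (c : ℤ_[p]) * ν (b α))
      - (1 - (c : ℤ_[p]) ^ (K + 1)) *
        ∑ α ∈ (range (p ^ (n + 1))).filter (fun α => ¬ p ∣ α), (α : ℤ_[p]) ^ K * ν α := by
  set s := (range (p ^ (n + 1))).filter (fun α => ¬ p ∣ α) with hs
  have hmaps : Set.MapsTo b s s := by
    intro α hα
    simp only [hs, coe_filter, mem_range, Set.mem_ofPred_eq] at hα ⊢
    refine ⟨(hb α).1, fun hd => hα.2 ?_⟩
    have h1 : (p : ℤ_[p]) ∣ (c : ℤ_[p]) * (b α : ℤ_[p]) - (α : ℤ_[p]) :=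
      (dvd_pow_self _ n.succ_ne_zero).trans (hb α).2
    have h2 : (p : ℤ_[p]) ∣ (b α : ℤ_[p]) := by exact_mod_cast map_dvd (Nat.castRingHom ℤ_[p]) hd
    have h3 : (p : ℤ_[p]) ∣ (α : ℤ_[p]) := (dvd_sub_right (h2.mul_left _)).1 h1
    have h4 : ((p ^ 1 : ℕ) : ℤ) ∣ (α : ℤ) := by
      rw [Nat.cast_pow, ← PadicInt.pow_p_dvd_int_iff]
      simpa using h3
    simpa using Int.natCast_dvd_natCast.1 h4
  have hinj : Set.InjOn b s := by
    intro α hα α' hα' h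
    simp only [hs, coe_filter, mem_range, Set.mem_ofPred_eq] at hα hα'
    have h1 := dvd_sub (hb α').2 (hb α).2
    rw [h, sub_sub_sub_cancel_left] at h1
    have h2 : ((p : ℤ) ^ (n + 1)) ∣ (α : ℤ) - α' := by
      rw [← PadicInt.pow_p_dvd_int_iff]
      push_cast
      exact h1
    have h3 : α' ≡ α [MOD p ^ (n + 1)] := by
      rw [Nat.modEq_iff_dvd]
      exact_mod_cast h2
    exact (Nat.ModEq.eq_of_lt_of_lt h3 hα'.1 hα.1).symm
  have hsurj : Set.SurjOn b s s := surjOn_of_injOn_of_card_le b hmaps hinj le_rfl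
  have hsum : ∑ α ∈ s, (α : ℤ_[p]) ^ K * ν α = ∑ α ∈ s, (b α : ℤ_[p]) ^ K * ν (b α) :=
    (sum_nbij b hmaps hinj hsurj fun _ _ => rfl).symm
  have key : ∑ α ∈ s, (α : ℤ_[p]) ^ K * (ν α - (c : ℤ_[p]) * ν (b α))
      - (1 - (c : ℤ_[p]) ^ (K + 1)) * ∑ α ∈ s, (α : ℤ_[p]) ^ K * ν α =
      ∑ α ∈ s, (((c : ℤ_[p]) * b α) ^ K - (α : ℤ_[p]) ^ K) * (c * ν (b α)) := by
    rw [sub_mul, one_mul]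
    nth_rewrite 2 [hsum]
    rw [mul_sum, sub_sub_eq_add_sub, ← sum_add_distrib, ← sum_sub_distrib]
    exact sum_congr rfl fun _ _ => by ring
  rw [key]
  exact dvd_sum fun α _ => ((hb α).2.trans (sub_dvd_pow_sub_pow _ _ _)).mul_right _

/-- Let `c` be a unit of `ℤ_p`. For every integer `k ≥ 1`, the sequence
`n ↦ Σ_{0 ≤ α < p^n, p ∤ α} α^{k−1}·μ_{c,n}(α)` converges in `ℚ_p` to
`(1 − c^k)·[(1/k)·(B_k(i/m) − B_k) − (p^{k−1}/k)·(B_k(r_1/m) − B_k)]`, where `μ_{c,n}(a) := μ_n(a) − c·μ_n(b)` with `b`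
the unique integer in `[0, p^n)` congruent to `c⁻¹·a` modulo `p^n`. -/
theorem stmt_12 (p : ℕ) [Fact p.Prime] (m i : ℕ) (hm : 1 < m) (hpm : ¬ p ∣ m)
    (hi : 0 < i) (him : i < m)
    (r : ℕ → ℕ) (hr : ∀ n : ℕ, r n < m ∧ (m : ℤ) ∣ (p : ℤ) ^ n * (r n : ℤ) - (i : ℤ))
    (k : ℕ → ℤ) (hk : ∀ n : ℕ, (m : ℤ) * k n = (p : ℤ) * (r (n + 1) : ℤ) - (r n : ℤ))
    (hk' : ∀ n : ℕ, 0 ≤ k n ∧ k n ≤ (p : ℤ) - 1)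
    (minv : ℤ_[p]) (hminv : (m : ℤ_[p]) * minv = 1)
    (T : ℕ → ℤ)
    (hT : ∀ n : ℕ, T n = 1 + ∑ α ∈ Finset.range n, ((p : ℤ) - 1 - k α) * (p : ℤ) ^ α)
    (δ : ℕ → ℕ → ℤ) (hδ : ∀ n a : ℕ, δ n a = if T n ≤ (a : ℤ) then -1 else 0)
    (μ : ℕ → ℕ → ℤ_[p])
    (hμ : ∀ n a : ℕ, μ n a = (r n : ℤ_[p]) * minv + (δ n a : ℤ_[p]))
    (c : ℤ_[p]ˣ)
    (b : ℕ → ℕ → ℕ)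
    (hb : ∀ n a : ℕ, b n a < p ^ n ∧
      (p : ℤ_[p]) ^ n ∣ (c : ℤ_[p]) * (b n a : ℤ_[p]) - (a : ℤ_[p]))
    (μc : ℕ → ℕ → ℤ_[p])
    (hμc : ∀ n a : ℕ, μc n a = μ n a - (c : ℤ_[p]) * μ n (b n a)) :
    ∀ K : ℕ, 1 ≤ K →
      Filter.Tendsto
        (fun n : ℕ => ∑ α ∈ (Finset.range (p ^ n)).filter (fun α => ¬ p ∣ α),
          (α : ℚ_[p]) ^ (K - 1) * (μc n α : ℚ_[p]))
        Filter.atTop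
        (nhds ((1 - ((c : ℤ_[p]) : ℚ_[p]) ^ K) *
          (((1 / (K : ℚ)) *
            (Polynomial.eval ((i : ℚ) / (m : ℚ)) (Polynomial.bernoulli K)
              - bernoulli K)
            - ((p : ℚ) ^ (K - 1) / (K : ℚ)) *
              (Polynomial.eval ((r 1 : ℚ) / (m : ℚ)) (Polynomial.bernoulli K)
                - bernoulli K) : ℚ) : ℚ_[p]))) := by
  intro K hK
  obtain ⟨K, rfl⟩ : ∃ K', K = K' + 1 := ⟨K - 1, by omega⟩
  have hp : 0 < p := (Fact.out : p.Prime).pos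
  have hm' : m ≠ 0 := by omega
  have hr0 : r 0 = i := by
    obtain ⟨h1, h2⟩ := hr 0
    have h3 : i ≡ r 0 [MOD m] := by
      rw [Nat.modEq_iff_dvd]
      simpa using h2
    exact (h3.eq_of_lt_of_lt him h1).symm
  have hm0 : (m : ℚ_[p]) ≠ 0 := by exact_mod_cast hm'
  have hminv' : (minv : ℚ_[p]) = (m : ℚ_[p])⁻¹ := by
    refine eq_inv_of_mul_eq_one_right ?_
    exact_mod_cast congrArg (Subtype.val : ℤ_[p] → ℚ_[p]) hminv
  have hμ' (n a : ℕ) : (μ n a : ℚ_[p]) =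
      (r n : ℚ_[p]) / m + if T n ≤ (a : ℤ) then -1 else 0 := by
    rw [hμ, hδ]
    split_ifs <;> simp [hminv', div_eq_mul_inv]
  have hfull := (tendsto_moment p m hm' r k T hk hk' hT K).comp (Filter.tendsto_add_atTop_nat 1)
  have hmult := (tendsto_moment p m hm' (fun n => r (n + 1)) (fun n => k (n + 1)) _
    (fun n => hk (n + 1)) (fun n => hk' (n + 1)) (fun _ => rfl) K).const_mul ((p : ℚ_[p]) ^ K)
  have hunits := (hfull.sub hmult).const_mul (1 - ((c : ℤ_[p]) : ℚ_[p]) ^ (K + 1))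
  rw [← Filter.tendsto_add_atTop_iff_nat 1]
  have herr : Filter.Tendsto (fun n : ℕ =>
      ∑ α ∈ (Finset.range (p ^ (n + 1))).filter (fun α => ¬ p ∣ α),
        (α : ℚ_[p]) ^ K * (μc (n + 1) α : ℚ_[p])
      - (1 - ((c : ℤ_[p]) : ℚ_[p]) ^ (K + 1)) *
        ∑ α ∈ (Finset.range (p ^ (n + 1))).filter (fun α => ¬ p ∣ α),
          (α : ℚ_[p]) ^ K * (μ (n + 1) α : ℚ_[p])) Filter.atTop (nhds 0) := by
    have hpow : Filter.Tendsto (fun n => (p : ℚ_[p]) ^ (n + 1)) Filter.atTop (nhds 0) :=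
      (tendsto_pow_atTop_nhds_zero_of_norm_lt_one Padic.norm_p_lt_one).comp
        (Filter.tendsto_add_atTop_nat 1)
    refine squeeze_zero_norm (fun n => ?_) (tendsto_zero_iff_norm_tendsto_zero.1 hpow)
    obtain ⟨d, hd⟩ := dvd_sum_twist_sub p c n (b (n + 1)) (hb (n + 1)) (μ (n + 1)) K
    simp only [← hμc] at hd
    have hd' := congrArg (PadicInt.Coe.ringHom (p := p)) hd
    simp only [map_sub, map_mul, map_sum, map_pow, map_one, map_natCast] at hd'
    refine (congrArg norm hd').trans_le ?_
    rw [norm_mul]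
    exact mul_le_of_le_one_right (norm_nonneg _) d.2
  convert herr.add hunits using 1
  · funext n
    rw [Nat.add_sub_cancel]
    have hsplit := sum_range_pow_filter_not_dvd p hp n
      (fun α => (α : ℚ_[p]) ^ K * (μ (n + 1) α : ℚ_[p]))
    rw [hsplit, Finset.mul_sum]
    simp only [hμ', Function.comp_apply, Nat.cast_mul, threshold_succ_le_mul p k T hk' hT n,
      mul_pow, mul_assoc]
    ring
  · rw [zero_add, hr0]
    congr 2
    push_cast
    ring
end

section
/- Let c be a unit of ℤ_p. For every integer k ≥ 1, the sequence n ↦ Σ_{0 ≤ α < p^n, p ∤ α} α^{k−1}·E_{1,c,n}(α) converges in ℚ_p to (1 − c^k)·(1 − p^{k−1})·B_k/k. -/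
open Filter Topology Finset

/-- The sum of the `K`-th powers of the naturals below `p ^ n` that are prime to `p`. -/
def primeToPowerSum (p K n : ℕ) : ℕ :=
  ∑ a ∈ (range (p ^ n)).filter (fun a => ¬ p ∣ a), a ^ K

theorem tendsto_padic_prime_pow (p : ℕ) [Fact p.Prime] :
    Tendsto (fun n : ℕ => (p : ℚ_[p]) ^ n) atTop (𝓝 0) :=
  tendsto_pow_atTop_nhds_zero_of_norm_lt_one Padic.norm_p_lt_one

theorem tendsto_sum_range_pow_div_prime_pow (p : ℕ) [Fact p.Prime] (K : ℕ) :
    Tendsto (fun n : ℕ => (∑ a ∈ range (p ^ n), (a : ℚ_[p]) ^ K) / (p : ℚ_[p]) ^ n) atTop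
      (𝓝 ((bernoulli K : ℚ) : ℚ_[p])) := by
  have hp : (p : ℚ_[p]) ≠ 0 := by exact_mod_cast (Fact.out : p.Prime).ne_zero
  have hK : ((K : ℚ_[p]) + 1) ≠ 0 := by exact_mod_cast K.succ_ne_zero
  have expand : ∀ n : ℕ, (∑ a ∈ range (p ^ n), (a : ℚ_[p]) ^ K) / (p : ℚ_[p]) ^ n =
      (∑ i ∈ range K, ((bernoulli i : ℚ) : ℚ_[p]) * ((K + 1).choose i : ℚ_[p]) / (K + 1) *
        ((p : ℚ_[p]) ^ n) ^ (K - i)) + ((bernoulli K : ℚ) : ℚ_[p]) := by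
    intro n
    have h := congrArg (fun x : ℚ => (x : ℚ_[p])) (sum_range_pow (p ^ n) K)
    push_cast at h
    rw [h, sum_range_succ, add_div, sum_div]
    congr 1
    · refine sum_congr rfl fun i hi => ?_
      have : K + 1 - i = (K - i) + 1 := by have := mem_range.1 hi; omega
      rw [this, pow_succ]
      field_simp
    · have : K + 1 - K = 1 := by omega
      rw [this, Nat.choose_succ_self_right]
      push_cast
      field_simp
  simp_rw [expand]
  have hsum : Tendsto (fun n : ℕ => ∑ i ∈ range K,
      ((bernoulli i : ℚ) : ℚ_[p]) * ((K + 1).choose i : ℚ_[p]) / (K + 1) *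
        ((p : ℚ_[p]) ^ n) ^ (K - i)) atTop (𝓝 (∑ i ∈ range K, 0)) := by
    refine tendsto_finsetSum _ fun i hi => ?_
    have hi' : K - i ≠ 0 := by have := mem_range.1 hi; omega
    simpa [hi'] using ((tendsto_padic_prime_pow p).pow (K - i)).const_mul
      (((bernoulli i : ℚ) : ℚ_[p]) * ((K + 1).choose i : ℚ_[p]) / (K + 1))
  simpa using hsum.add_const ((bernoulli K : ℚ) : ℚ_[p])

theorem sum_range_pow_eq_primeToPowerSum_add (p : ℕ) (hp : p.Prime) (K n : ℕ) :
    ∑ a ∈ range (p ^ (n + 1)), a ^ K =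
      primeToPowerSum p K (n + 1) + p ^ K * ∑ a ∈ range (p ^ n), a ^ K := by
  rw [primeToPowerSum, ← sum_filter_not_add_sum_filter (range (p ^ (n + 1))) (fun a => p ∣ a)]
  congr 1
  rw [mul_sum]
  symm
  refine sum_nbij (fun a => p * a) ?_ ?_ ?_ ?_
  · intro a ha
    have ha := mem_range.1 ha
    simp only [mem_filter, mem_range, dvd_mul_right, and_true, pow_succ']
    exact Nat.mul_lt_mul_of_pos_left ha hp.pos
  · intro a _ b _ h
    exact Nat.eq_of_mul_eq_mul_left hp.pos h
  · intro x hx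
    obtain ⟨hx, y, rfl⟩ := mem_filter.1 (mem_coe.1 hx)
    refine ⟨y, ?_, rfl⟩
    rw [mem_range, pow_succ'] at hx
    exact mem_coe.2 (mem_range.2 (Nat.lt_of_mul_lt_mul_left hx))
  · intro a _
    rw [mul_pow]

theorem tendsto_primeToPowerSum_div (p : ℕ) [Fact p.Prime] (K : ℕ) :
    Tendsto (fun n : ℕ => (primeToPowerSum p K n : ℚ_[p]) / (p : ℚ_[p]) ^ n) atTop
      (𝓝 ((1 - (p : ℚ_[p]) ^ K / p) * ((bernoulli K : ℚ) : ℚ_[p]))) := by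
  have hp : (p : ℚ_[p]) ≠ 0 := by exact_mod_cast (Fact.out : p.Prime).ne_zero
  rw [← tendsto_add_atTop_iff_nat 1]
  have h := tendsto_sum_range_pow_div_prime_pow p K
  have h' := ((tendsto_add_atTop_iff_nat 1).2 h).sub (h.const_mul ((p : ℚ_[p]) ^ K / p))
  rw [sub_mul, one_mul]
  refine h'.congr fun n => ?_
  have e := congrArg (fun x : ℕ => (x : ℚ_[p]))
    (sum_range_pow_eq_primeToPowerSum_add p Fact.out K n)
  push_cast at e
  rw [e, pow_succ]
  field_simp
  ring

theorem tendsto_primeToPowerSum_zero (p : ℕ) [Fact p.Prime] (K : ℕ) :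
    Tendsto (fun n : ℕ => (primeToPowerSum p K n : ℚ_[p])) atTop (𝓝 0) := by
  have hp : (p : ℚ_[p]) ≠ 0 := by exact_mod_cast (Fact.out : p.Prime).ne_zero
  have h := (tendsto_primeToPowerSum_div p K).mul (tendsto_padic_prime_pow p)
  rw [mul_zero] at h
  exact h.congr fun n => div_mul_cancel₀ _ (pow_ne_zero n hp)

/-- Multiplication by a `p`-adic unit permutes the residues modulo `p ^ n` prime to `p`. -/
theorem sum_comp_unit_mul_residue {M : Type*} [AddCommMonoid M] (p : ℕ) [Fact p.Prime]
    (c : ℤ_[p]) {n : ℕ} (hn : 1 ≤ n) (b : ℕ → ℕ)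
    (hb : ∀ a : ℕ, b a < p ^ n ∧ (p : ℤ_[p]) ^ n ∣ c * (b a : ℤ_[p]) - (a : ℤ_[p]))
    (f : ℕ → M) :
    ∑ a ∈ (range (p ^ n)).filter (fun a => ¬ p ∣ a), f (b a) =
      ∑ a ∈ (range (p ^ n)).filter (fun a => ¬ p ∣ a), f a := by
  set U := (range (p ^ n)).filter (fun a => ¬ p ∣ a) with hU
  have maps : Set.MapsTo b U U := by
    intro a ha
    obtain ⟨_, ha⟩ := mem_filter.1 (mem_coe.1 ha)
    refine mem_coe.2 (mem_filter.2 ⟨mem_range.2 (hb a).1, fun hd => ha ?_⟩)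
    have h1 : (p : ℤ_[p]) ∣ c * (b a : ℤ_[p]) - (a : ℤ_[p]) :=
      (dvd_pow_self _ (by omega)).trans (hb a).2
    have h2 : (p : ℤ_[p]) ∣ c * (b a : ℤ_[p]) :=
      (Nat.cast_dvd_cast hd).mul_left c
    have h3 : (p : ℤ_[p]) ^ 1 ∣ ((a : ℤ) : ℤ_[p]) := by
      simpa using (dvd_sub_right h2).1 h1
    rw [PadicInt.pow_p_dvd_int_iff] at h3
    exact_mod_cast (by simpa using h3 : (p : ℤ) ∣ (a : ℤ))
  have inj : Set.InjOn b U := by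
    intro x hx y hy hxy
    have hx := mem_range.1 (mem_filter.1 (mem_coe.1 hx)).1
    have hy := mem_range.1 (mem_filter.1 (mem_coe.1 hy)).1
    have h := dvd_sub (hb x).2 (hb y).2
    rw [hxy, sub_sub_sub_cancel_left] at h
    have h' : (p : ℤ_[p]) ^ n ∣ (((y : ℤ) - (x : ℤ) : ℤ) : ℤ_[p]) := by simpa using h
    rw [PadicInt.pow_p_dvd_int_iff] at h'
    have hmod : x ≡ y [MOD p ^ n] := (Nat.modEq_iff_dvd).2 (by exact_mod_cast h')
    exact hmod.eq_of_lt_of_lt hx hy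
  exact sum_nbij b maps inj (surjOn_of_injOn_of_card_le b maps inj le_rfl) fun _ _ => rfl

/-- The twisted power sum of the Bernoulli measure `E_{1,c}`, up to an error divisible by `p ^ n`. -/
theorem exists_sum_pow_mul_bernoulliMeasure_eq (p : ℕ) [Fact p.Prime]
    (c : ℤ_[p]) {n : ℕ} (hn : 1 ≤ n) (b : ℕ → ℕ)
    (hb : ∀ a : ℕ, b a < p ^ n ∧ (p : ℤ_[p]) ^ n ∣ c * (b a : ℤ_[p]) - (a : ℤ_[p]))
    {K : ℕ} (hK : 1 ≤ K) :
    ∃ r : ℤ_[p], ∑ a ∈ (range (p ^ n)).filter (fun a => ¬ p ∣ a), (a : ℚ_[p]) ^ (K - 1) *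
        ((a : ℚ_[p]) / (p : ℚ_[p]) ^ n - (c : ℚ_[p]) * (b a : ℚ_[p]) / (p : ℚ_[p]) ^ n
          + ((c : ℚ_[p]) - 1) / 2) =
      (1 - (c : ℚ_[p]) ^ K) / K * ((primeToPowerSum p K n : ℚ_[p]) / (p : ℚ_[p]) ^ n)
        + (p : ℚ_[p]) ^ n * (r : ℚ_[p]) / K
        + ((c : ℚ_[p]) - 1) / 2 * (primeToPowerSum p (K - 1) n : ℚ_[p]) := by
  have hp : (p : ℚ_[p]) ≠ 0 := by exact_mod_cast (Fact.out : p.Prime).ne_zero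
  have hK0 : (K : ℚ_[p]) ≠ 0 := by exact_mod_cast (by omega : K ≠ 0)
  choose t ht using fun a => (hb a).2
  have hexp : ∀ a : ℕ, ∃ e : ℤ_[p], c ^ K * (b a : ℤ_[p]) ^ K =
      (a : ℤ_[p]) ^ K + K * (a : ℤ_[p]) ^ (K - 1) * ((p : ℤ_[p]) ^ n * t a)
        + ((p : ℤ_[p]) ^ n) ^ 2 * e := by
    intro a
    obtain ⟨k, hk⟩ := Polynomial.powAddExpansion (a : ℤ_[p]) ((p : ℤ_[p]) ^ n * t a) K
    refine ⟨k * t a ^ 2, ?_⟩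
    rw [← mul_pow, show c * (b a : ℤ_[p]) = a + (p : ℤ_[p]) ^ n * t a by rw [← ht a]; ring, hk]
    ring
  choose e he using hexp
  set U := (range (p ^ n)).filter (fun a => ¬ p ∣ a) with hU
  refine ⟨∑ a ∈ U, e a, ?_⟩
  have hq : (p : ℚ_[p]) ^ n ≠ 0 := pow_ne_zero n hp
  have hS : ∀ j : ℕ, (primeToPowerSum p j n : ℚ_[p]) = ∑ a ∈ U, (a : ℚ_[p]) ^ j := by
    intro j
    simp [primeToPowerSum, hU]
  have hterm : ∀ a ∈ U, (a : ℚ_[p]) ^ (K - 1) *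
        ((a : ℚ_[p]) / (p : ℚ_[p]) ^ n - (c : ℚ_[p]) * (b a : ℚ_[p]) / (p : ℚ_[p]) ^ n
          + ((c : ℚ_[p]) - 1) / 2) =
      ((a : ℚ_[p]) ^ K - (c : ℚ_[p]) ^ K * (b a : ℚ_[p]) ^ K) / (K * (p : ℚ_[p]) ^ n)
        + (p : ℚ_[p]) ^ n / K * (e a : ℚ_[p])
        + ((c : ℚ_[p]) - 1) / 2 * (a : ℚ_[p]) ^ (K - 1) := by
    intro a _
    have h1 := congrArg (fun x : ℤ_[p] => (x : ℚ_[p])) (ht a)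
    have h2 := congrArg (fun x : ℤ_[p] => (x : ℚ_[p])) (he a)
    push_cast at h1 h2
    rw [h2, show (c : ℚ_[p]) * (b a : ℚ_[p]) = a + (p : ℚ_[p]) ^ n * t a by rw [← h1]; ring]
    field_simp
    ring
  rw [sum_congr rfl hterm, sum_add_distrib, sum_add_distrib, ← mul_sum, ← mul_sum, ← sum_div,
    sum_sub_distrib, ← mul_sum,
    sum_comp_unit_mul_residue p c hn b hb (fun x => (x : ℚ_[p]) ^ K), ← hU, hS, hS,
    PadicInt.coe_sum]
  field_simp

/-- Let `c` be a unit of `ℤ_p`. For every integer `k ≥ 1`, the sequence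
`n ↦ Σ_{0 ≤ α < p^n, p ∤ α} α^{k−1}·E_{1,c,n}(α)` converges in `ℚ_p` to
`(1 − c^k)·(1 − p^{k−1})·B_k/k`, where
`E_{1,c,n}(a) := a/p^n − c·b/p^n + (c−1)/2` with `b` the unique integer in `[0, p^n)`
congruent to `c⁻¹·a` modulo `p^n` in `ℤ_p` (values of the Bernoulli measure `E_{1,c}`). -/
theorem stmt_15 (p : ℕ) [Fact p.Prime]
    (c : ℤ_[p]ˣ)
    (b : ℕ → ℕ → ℕ)
    (hb : ∀ n a : ℕ, b n a < p ^ n ∧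
      (p : ℤ_[p]) ^ n ∣ (c : ℤ_[p]) * (b n a : ℤ_[p]) - (a : ℤ_[p]))
    (E : ℕ → ℕ → ℚ_[p])
    (hE : ∀ n a : ℕ, 1 ≤ n →
      E n a = (a : ℚ_[p]) / (p : ℚ_[p]) ^ n
        - ((c : ℤ_[p]) : ℚ_[p]) * (b n a : ℚ_[p]) / (p : ℚ_[p]) ^ n
        + (((c : ℤ_[p]) : ℚ_[p]) - 1) / 2) :
    ∀ K : ℕ, 1 ≤ K →
      Filter.Tendsto
        (fun n : ℕ => ∑ α ∈ (Finset.range (p ^ n)).filter (fun α => ¬ p ∣ α),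
          (α : ℚ_[p]) ^ (K - 1) * E n α)
        Filter.atTop
        (nhds ((1 - ((c : ℤ_[p]) : ℚ_[p]) ^ K) * (1 - (p : ℚ_[p]) ^ (K - 1)) *
          ((bernoulli K : ℚ) : ℚ_[p]) / (K : ℚ_[p]))) := by
  intro K hK
  have hp : (p : ℚ_[p]) ≠ 0 := by exact_mod_cast (Fact.out : p.Prime).ne_zero
  have key : ∀ n : ℕ, ∃ r : ℤ_[p], 1 ≤ n →
      ∑ α ∈ (range (p ^ n)).filter (fun α => ¬ p ∣ α), (α : ℚ_[p]) ^ (K - 1) * E n α =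
        (1 - ((c : ℤ_[p]) : ℚ_[p]) ^ K) / K *
            ((primeToPowerSum p K n : ℚ_[p]) / (p : ℚ_[p]) ^ n)
          + (p : ℚ_[p]) ^ n * (r : ℚ_[p]) / K
          + (((c : ℤ_[p]) : ℚ_[p]) - 1) / 2 * (primeToPowerSum p (K - 1) n : ℚ_[p]) := by
    intro n
    by_cases hn : 1 ≤ n
    · obtain ⟨r, hr⟩ := exists_sum_pow_mul_bernoulliMeasure_eq p c hn (b n) (hb n) hK
      exact ⟨r, fun _ => by simpa only [hE n _ hn] using hr⟩
    · exact ⟨0, fun h => absurd h hn⟩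
  choose r hr using key
  have herr : Tendsto (fun n : ℕ => (p : ℚ_[p]) ^ n * (r n : ℚ_[p])) atTop (𝓝 0) := by
    refine squeeze_zero_norm (fun n => ?_)
      (tendsto_zero_iff_norm_tendsto_zero.1 (tendsto_padic_prime_pow p))
    rw [norm_mul]
    exact mul_le_of_le_one_right (norm_nonneg _) (r n).2
  have hlim := (((tendsto_primeToPowerSum_div p K).const_mul
    ((1 - ((c : ℤ_[p]) : ℚ_[p]) ^ K) / K)).add (herr.div_const (K : ℚ_[p]))).add
    ((tendsto_primeToPowerSum_zero p (K - 1)).const_mul ((((c : ℤ_[p]) : ℚ_[p]) - 1) / 2))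
  have hpow : (p : ℚ_[p]) ^ K / p = (p : ℚ_[p]) ^ (K - 1) := by
    rw [div_eq_iff hp, ← pow_succ, Nat.sub_add_cancel hK]
  rw [hpow, zero_div, add_zero, mul_zero, add_zero] at hlim
  have hlim' := hlim.congr' ((eventually_ge_atTop 1).mono fun n hn => (hr n hn).symm)
  convert hlim' using 2
  ring
end

section
/- Let c be a unit of ℤ_p. For every integer k ≥ 1, the sequence n ↦ Σ_{α=0}^{p^n−1} α^{k−1}·(μ_{c,n}(α) + E_{1,c,n}(α)) converges in ℚ_p to (1 − c^k)·B_k(i/m)/k. (This is the measure-theoretic content of Corollary 3.6 i): for σ with χ(σ) = c, (1/(1−c^k))·∫_{ℤ_p} x^{k−1} d(K(ξ_m^{−i})(σ) + ι(K(ξ_m^i)(σ))) = B_k(i/m)/k.) -/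
open Filter Topology in
/-- Volkenborn-type limit: `p⁻ⁿ ∑_{j < pⁿ} (x + j)^K` tends `p`-adically to `B_K(x)`. -/
theorem tendsto_sum_add_pow_div_pow (p : ℕ) [Fact p.Prime] (x : ℚ) (K : ℕ) :
    Tendsto (fun n : ℕ => (∑ j ∈ Finset.range (p ^ n), ((x : ℚ_[p]) + j) ^ K) / (p : ℚ_[p]) ^ n)
      atTop (𝓝 (((Polynomial.bernoulli K).eval x : ℚ) : ℚ_[p])) := by
  have hp0 : (p : ℚ_[p]) ≠ 0 := by exact_mod_cast (Fact.out : p.Prime).ne_zero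
  have hK : ((K : ℚ_[p]) + 1) ≠ 0 := by exact_mod_cast K.succ_ne_zero
  set P : Polynomial ℚ_[p] := (Polynomial.bernoulli (K + 1)).map (algebraMap ℚ ℚ_[p]) with hP
  have hPe (y : ℚ) : P.eval (y : ℚ_[p]) = (((Polynomial.bernoulli (K + 1)).eval y : ℚ) : ℚ_[p]) :=
    Polynomial.eval_map_apply (f := algebraMap ℚ ℚ_[p]) y
  have htel (N : ℕ) : ((K : ℚ) + 1) * ∑ j ∈ Finset.range N, (x + j) ^ K =
      (Polynomial.bernoulli (K + 1)).eval (x + N) - (Polynomial.bernoulli (K + 1)).eval x := by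
    induction N with
    | zero => simp
    | succ N ih =>
      have h := Polynomial.bernoulli_eval_one_add (K + 1) (x + N)
      rw [Finset.sum_range_succ, mul_add, ih]
      push_cast at h ⊢
      rw [show x + ((N : ℚ) + 1) = 1 + (x + N) by ring, h]
      ring
  have hder : P.derivative.eval (x : ℚ_[p]) =
      ((K : ℚ_[p]) + 1) * (((Polynomial.bernoulli K).eval x : ℚ) : ℚ_[p]) := by
    rw [hP, Polynomial.derivative_map, Polynomial.derivative_bernoulli_add_one]
    have := Polynomial.eval_map_apply (f := algebraMap ℚ ℚ_[p])
      (p := ((K : Polynomial ℚ) + 1) * Polynomial.bernoulli K) x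
    simpa using this
  have hlim := (hasDerivAt_iff_tendsto_slope_zero.1 (P.hasDerivAt (x : ℚ_[p])))
  have hq : Tendsto (fun n : ℕ => (p : ℚ_[p]) ^ n) atTop (𝓝[≠] 0) :=
    tendsto_nhdsWithin_iff.2 ⟨tendsto_pow_atTop_nhds_zero_of_norm_lt_one Padic.norm_p_lt_one,
      Eventually.of_forall fun n => pow_ne_zero n hp0⟩
  have h := (hlim.comp hq).const_mul ((K : ℚ_[p]) + 1)⁻¹
  rw [hder, inv_mul_cancel_left₀ hK] at h
  refine h.congr fun n => ?_
  have h1 : ((K : ℚ_[p]) + 1) * ∑ j ∈ Finset.range (p ^ n), ((x : ℚ_[p]) + j) ^ K =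
      P.eval ((x : ℚ_[p]) + (p : ℚ_[p]) ^ n) - P.eval (x : ℚ_[p]) := by
    have h2 := congrArg (fun y : ℚ => (y : ℚ_[p])) (htel (p ^ n))
    have h3 := hPe (x + (p ^ n : ℕ))
    have h4 := hPe x
    push_cast at h2 h3
    rw [h3, h4, h2]
  simp only [Function.comp_apply, smul_eq_mul]
  rw [← h1]
  field_simp

/-- A self-map `f` of `[0, pⁿ)` solving an affine congruence `y * f a + z ≡ a` modulo `pⁿ` is a
permutation. -/
theorem sum_comp_eq_sum_of_dvd_affine {p : ℕ} [Fact p.Prime] {n : ℕ} {f : ℕ → ℕ} {y z : ℤ_[p]}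
    (hlt : ∀ a < p ^ n, f a < p ^ n)
    (hdvd : ∀ a < p ^ n, (p : ℤ_[p]) ^ n ∣ y * (f a : ℤ_[p]) + z - (a : ℤ_[p]))
    {R : Type*} [AddCommMonoid R] (g : ℕ → R) :
    ∑ a ∈ Finset.range (p ^ n), g (f a) = ∑ a ∈ Finset.range (p ^ n), g a := by
  have hmaps : Set.MapsTo f (Finset.range (p ^ n) : Set ℕ) (Finset.range (p ^ n) : Set ℕ) := by
    intro a ha
    simpa using hlt a (by simpa using ha)
  have hinj : Set.InjOn f (Finset.range (p ^ n) : Set ℕ) := by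
    intro a ha a' ha' haa
    have ha : a < p ^ n := by simpa using ha
    have ha' : a' < p ^ n := by simpa using ha'
    have h := dvd_sub (hdvd a' ha') (hdvd a ha)
    rw [haa, sub_sub_sub_cancel_left] at h
    have h' : ((p : ℤ) ^ n) ∣ (a : ℤ) - a' := by
      rw [← PadicInt.pow_p_dvd_int_iff]
      push_cast
      exact h
    have hmod : a' ≡ a [MOD p ^ n] := (Nat.modEq_iff_dvd).2 (by exact_mod_cast h')
    exact (Nat.ModEq.eq_of_lt_of_lt hmod ha' ha).symm
  exact Finset.sum_nbij f hmaps hinj (Finset.surjOn_of_injOn_of_card_le f hmaps hinj le_rfl)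
    fun _ _ => rfl

theorem exists_add_mul_pow_eq {R : Type*} [CommRing R] (a q s : R) (K : ℕ) :
    ∃ e, (a + q * s) ^ K = a ^ K + K * a ^ (K - 1) * (q * s) + q ^ 2 * e := by
  obtain ⟨e, he⟩ := Polynomial.powAddExpansion a (q * s) K
  exact ⟨e * s ^ 2, by rw [he]; ring⟩

/-- The value `μ_n(a)` satisfies `a + pⁿ μ_n(a) = a' + i/m` for some integer `0 ≤ a' < pⁿ`. -/
theorem exists_add_pow_mul_measure_eq {p m i n a : ℕ} [Fact p.Prime] (hi : 0 < i) (him : i < m)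
    {r : ℕ → ℕ} (hr : ∀ n : ℕ, r n < m ∧ (m : ℤ) ∣ (p : ℤ) ^ n * (r n : ℤ) - (i : ℤ))
    {k : ℕ → ℤ} (hk : ∀ n : ℕ, (m : ℤ) * k n = (p : ℤ) * (r (n + 1) : ℤ) - (r n : ℤ))
    {minv : ℤ_[p]} (hminv : (m : ℤ_[p]) * minv = 1) (ha : a < p ^ n) :
    ∃ a' < p ^ n, (a : ℤ_[p]) + (p : ℤ_[p]) ^ n * ((r n : ℤ_[p]) * minv +
      ((if 1 + ∑ α ∈ Finset.range n, ((p : ℤ) - 1 - k α) * (p : ℤ) ^ α ≤ (a : ℤ)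
        then -1 else 0 : ℤ) : ℤ_[p])) = a' + i * minv := by
  have hmpos : (0 : ℤ) < m := by omega
  have hr0 : (r 0 : ℤ) = i := by
    obtain ⟨h1, h2⟩ := hr 0
    rw [pow_zero, one_mul] at h2
    have := Int.eq_zero_of_abs_lt_dvd h2 (by rw [abs_lt]; omega)
    omega
  have hsum (n : ℕ) : 1 + ∑ α ∈ Finset.range n, ((p : ℤ) - 1 - k α) * (p : ℤ) ^ α =
      (p : ℤ) ^ n - ∑ α ∈ Finset.range n, k α * (p : ℤ) ^ α := by
    induction n with
    | zero => simp
    | succ n ih => rw [Finset.sum_range_succ, Finset.sum_range_succ, ← add_assoc, ih]; ring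
  have hN (n : ℕ) : (m : ℤ) * ∑ α ∈ Finset.range n, k α * (p : ℤ) ^ α =
      (p : ℤ) ^ n * r n - i := by
    induction n with
    | zero => simp [hr0]
    | succ n ih =>
      rw [Finset.sum_range_succ, mul_add, ih, ← mul_assoc, hk]
      ring
  rw [hsum]
  generalize hNdef : ∑ α ∈ Finset.range n, k α * (p : ℤ) ^ α = N
  have hN := hNdef ▸ hN n
  have hq : (0 : ℤ) < (p : ℤ) ^ n := pow_pos (by exact_mod_cast (Fact.out : p.Prime).pos) n
  have haq : (a : ℤ) < (p : ℤ) ^ n := by exact_mod_cast ha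
  have hrm : (r n : ℤ) < m := by exact_mod_cast (hr n).1
  have hN0 : 0 ≤ N := by
    by_contra! h
    nlinarith [mul_nonneg hq.le (Int.natCast_nonneg (r n))]
  have hNq : N < (p : ℤ) ^ n := by
    by_contra! h
    nlinarith
  obtain ⟨d, hd⟩ : ∃ d : ℤ, d = if (p : ℤ) ^ n - N ≤ (a : ℤ) then -1 else 0 := ⟨_, rfl⟩
  rw [← hd]
  have hb : 0 ≤ (a : ℤ) + N + (p : ℤ) ^ n * d ∧ (a : ℤ) + N + (p : ℤ) ^ n * d < (p : ℤ) ^ n := by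
    split_ifs at hd <;> subst hd <;> constructor <;> linarith
  obtain ⟨a', ha'⟩ := Int.eq_ofNat_of_zero_le hb.1
  refine ⟨a', by rw [ha'] at hb; exact_mod_cast hb.2, ?_⟩
  have h1 : (a' : ℤ_[p]) = a + N + (p : ℤ_[p]) ^ n * d := by
    have := congrArg (fun t : ℤ => (t : ℤ_[p])) ha'
    push_cast at this
    exact this.symm
  have h2 : (m : ℤ_[p]) * N = (p : ℤ_[p]) ^ n * r n - i := by
    exact_mod_cast congrArg (fun t : ℤ => (t : ℤ_[p])) hN
  rw [h1]
  linear_combination (-minv) * h2 + (N : ℤ_[p]) * hminv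


/-- Let `c` be a unit of `ℤ_p`. For every integer `k ≥ 1`, the sequence
`n ↦ Σ_{α=0}^{p^n−1} α^{k−1}·(μ_{c,n}(α) + E_{1,c,n}(α))` converges in `ℚ_p` to
`(1 − c^k)·B_k(i/m)/k`.  (Measure-theoretic content of Corollary 3.6 i): for `σ` with
`χ(σ) = c`, `(1/(1−c^k))·∫_{ℤ_p} x^{k−1} d(K(ξ_m^{−i})(σ) + ι(K(ξ_m^i)(σ))) = B_k(i/m)/k`.) -/
theorem stmt_16 (p : ℕ) [Fact p.Prime] (m i : ℕ) (hm : 1 < m) (hpm : ¬ p ∣ m)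
    (hi : 0 < i) (him : i < m)
    (r : ℕ → ℕ) (hr : ∀ n : ℕ, r n < m ∧ (m : ℤ) ∣ (p : ℤ) ^ n * (r n : ℤ) - (i : ℤ))
    (k : ℕ → ℤ) (hk : ∀ n : ℕ, (m : ℤ) * k n = (p : ℤ) * (r (n + 1) : ℤ) - (r n : ℤ))
    (hk' : ∀ n : ℕ, 0 ≤ k n ∧ k n ≤ (p : ℤ) - 1)
    (minv : ℤ_[p]) (hminv : (m : ℤ_[p]) * minv = 1)
    (T : ℕ → ℤ)
    (hT : ∀ n : ℕ, T n = 1 + ∑ α ∈ Finset.range n, ((p : ℤ) - 1 - k α) * (p : ℤ) ^ α)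
    (δ : ℕ → ℕ → ℤ) (hδ : ∀ n a : ℕ, δ n a = if T n ≤ (a : ℤ) then -1 else 0)
    (μ : ℕ → ℕ → ℤ_[p])
    (hμ : ∀ n a : ℕ, μ n a = (r n : ℤ_[p]) * minv + (δ n a : ℤ_[p]))
    (c : ℤ_[p]ˣ)
    (b : ℕ → ℕ → ℕ)
    (hb : ∀ n a : ℕ, b n a < p ^ n ∧
      (p : ℤ_[p]) ^ n ∣ (c : ℤ_[p]) * (b n a : ℤ_[p]) - (a : ℤ_[p]))
    (μc : ℕ → ℕ → ℤ_[p])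
    (hμc : ∀ n a : ℕ, μc n a = μ n a - (c : ℤ_[p]) * μ n (b n a))
    (E : ℕ → ℕ → ℚ_[p])
    (hE : ∀ n a : ℕ, 1 ≤ n →
      E n a = (a : ℚ_[p]) / (p : ℚ_[p]) ^ n
        - ((c : ℤ_[p]) : ℚ_[p]) * (b n a : ℚ_[p]) / (p : ℚ_[p]) ^ n
        + (((c : ℤ_[p]) : ℚ_[p]) - 1) / 2) :
    ∀ K : ℕ, 1 ≤ K →
      Filter.Tendsto
        (fun n : ℕ => ∑ α ∈ Finset.range (p ^ n),
          (α : ℚ_[p]) ^ (K - 1) * ((μc n α : ℚ_[p]) + E n α))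
        Filter.atTop
        (nhds ((1 - ((c : ℤ_[p]) : ℚ_[p]) ^ K) *
          ((Polynomial.eval ((i : ℚ) / (m : ℚ)) (Polynomial.bernoulli K) / (K : ℚ)
            : ℚ) : ℚ_[p]))) := by
  intro K hK
  have hp0 : (p : ℚ_[p]) ≠ 0 := by exact_mod_cast (Fact.out : p.Prime).ne_zero
  have hK0 : (K : ℚ_[p]) ≠ 0 := by exact_mod_cast (by omega : K ≠ 0)
  have hm0 : (m : ℚ_[p]) ≠ 0 := by exact_mod_cast (by omega : m ≠ 0)
  have hqlim : Filter.Tendsto (fun n : ℕ => (p : ℚ_[p]) ^ n) Filter.atTop (nhds 0) :=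
    tendsto_pow_atTop_nhds_zero_of_norm_lt_one Padic.norm_p_lt_one
  set x : ℚ := (i : ℚ) / m with hx
  have hxcoe : ((i * minv : ℤ_[p]) : ℚ_[p]) = (x : ℚ_[p]) := by
    have h : (m : ℚ_[p]) * (minv : ℚ_[p]) = 1 := by
      exact_mod_cast congrArg (fun t : ℤ_[p] => (t : ℚ_[p])) hminv
    rw [hx]
    push_cast
    rw [eq_div_iff hm0]
    linear_combination (i : ℚ_[p]) * h
  have hA (n a : ℕ) (ha : a < p ^ n) :
      ∃ a' < p ^ n, (a : ℤ_[p]) + (p : ℤ_[p]) ^ n * μ n a = a' + i * minv := by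
    rw [hμ, hδ, hT]
    exact exists_add_pow_mul_measure_eq hi him hr hk hminv ha
  have hsumA (n : ℕ) :
      ∑ a ∈ Finset.range (p ^ n), ((a : ℤ_[p]) + (p : ℤ_[p]) ^ n * μ n a) ^ K =
        ∑ j ∈ Finset.range (p ^ n), ((i : ℤ_[p]) * minv + j) ^ K := by
    choose! f hf hfA using hA n
    rw [← sum_comp_eq_sum_of_dvd_affine (f := f) (y := 1) (z := (i : ℤ_[p]) * minv) hf
      (fun a ha => ⟨μ n a, by linear_combination -hfA a ha⟩)
      (fun j => ((i : ℤ_[p]) * minv + j) ^ K)]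
    refine Finset.sum_congr rfl fun a ha => ?_
    rw [hfA a (Finset.mem_range.1 ha), add_comm]
  have hsumB (n : ℕ) :
      ∑ a ∈ Finset.range (p ^ n), ((b n a : ℤ_[p]) + (p : ℤ_[p]) ^ n * μ n (b n a)) ^ K =
        ∑ j ∈ Finset.range (p ^ n), ((i : ℤ_[p]) * minv + j) ^ K := by
    rw [← hsumA]
    exact sum_comp_eq_sum_of_dvd_affine (f := b n) (y := c) (z := 0) (fun a _ => (hb n a).1)
      (fun a _ => by simpa using (hb n a).2)
      (fun a => ((a : ℤ_[p]) + (p : ℤ_[p]) ^ n * μ n a) ^ K)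
  choose w hw using fun n a => (hb n a).2
  have hmain (n : ℕ) : ∃ e : ℤ_[p],
      (K : ℤ_[p]) * (p : ℤ_[p]) ^ n *
        ∑ a ∈ Finset.range (p ^ n), (a : ℤ_[p]) ^ (K - 1) * (μc n a - w n a) =
      (1 - (c : ℤ_[p]) ^ K) * ∑ j ∈ Finset.range (p ^ n), ((i : ℤ_[p]) * minv + j) ^ K
        + ((p : ℤ_[p]) ^ n) ^ 2 * e := by
    choose e he using fun a : ℕ => exists_add_mul_pow_eq (a : ℤ_[p]) ((p : ℤ_[p]) ^ n) (μ n a) K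
    choose e' he' using fun a : ℕ => exists_add_mul_pow_eq (a : ℤ_[p]) ((p : ℤ_[p]) ^ n)
      (w n a + c * μ n (b n a)) K
    refine ⟨∑ a ∈ Finset.range (p ^ n), (e' a - e a), ?_⟩
    rw [sub_mul, one_mul]
    nth_rewrite 1 [← hsumA]
    rw [← hsumB, Finset.mul_sum, Finset.mul_sum, Finset.mul_sum, ← Finset.sum_sub_distrib,
      ← Finset.sum_add_distrib]
    refine Finset.sum_congr rfl fun a _ => ?_
    rw [← mul_pow, show (c : ℤ_[p]) * ((b n a : ℤ_[p]) + (p : ℤ_[p]) ^ n * μ n (b n a)) =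
      a + (p : ℤ_[p]) ^ n * (w n a + c * μ n (b n a)) by linear_combination hw n a, he, he', hμc]
    ring
  choose e he using hmain
  have herr : Filter.Tendsto (fun n : ℕ => (p : ℚ_[p]) ^ n * (e n : ℚ_[p]) / K)
      Filter.atTop (nhds 0) := by
    have h : Filter.Tendsto (fun n : ℕ => (p : ℚ_[p]) ^ n * (e n : ℚ_[p])) Filter.atTop
        (nhds 0) := by
      refine squeeze_zero_norm (fun n => ?_) (tendsto_zero_iff_norm_tendsto_zero.1 hqlim)
      rw [norm_mul]
      exact mul_le_of_le_one_right (norm_nonneg _) (e n).2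
    simpa using h.div_const (K : ℚ_[p])
  have hpow : Filter.Tendsto
      (fun n : ℕ => (((c : ℤ_[p]) : ℚ_[p]) - 1) / 2 *
        ∑ a ∈ Finset.range (p ^ n), (a : ℚ_[p]) ^ (K - 1)) Filter.atTop (nhds 0) := by
    have h := ((tendsto_sum_add_pow_div_pow p 0 (K - 1)).mul hqlim).const_mul
      ((((c : ℤ_[p]) : ℚ_[p]) - 1) / 2)
    rw [mul_zero, mul_zero] at h
    refine h.congr fun n => ?_
    rw [div_mul_cancel₀ _ (pow_ne_zero n hp0)]
    simp
  have hlim := (((tendsto_sum_add_pow_div_pow p x K).const_mul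
    ((1 - ((c : ℤ_[p]) : ℚ_[p]) ^ K) / K)).add herr).add hpow
  rw [add_zero, add_zero] at hlim
  refine (hlim.congr' ?_).trans_eq ?_
  · filter_upwards [Filter.eventually_ge_atTop 1] with n hn
    have hq0 : (p : ℚ_[p]) ^ n ≠ 0 := pow_ne_zero n hp0
    have hEn (a : ℕ) : (μc n a : ℚ_[p]) + E n a =
        ((μc n a - w n a : ℤ_[p]) : ℚ_[p]) + (((c : ℤ_[p]) : ℚ_[p]) - 1) / 2 := by
      have h : ((c : ℤ_[p]) : ℚ_[p]) * b n a - a = (p : ℚ_[p]) ^ n * w n a := by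
        exact_mod_cast congrArg (fun t : ℤ_[p] => (t : ℚ_[p])) (hw n a)
      rw [hE n a hn, ← sub_div,
        show (a : ℚ_[p]) - ((c : ℤ_[p]) : ℚ_[p]) * b n a = (p : ℚ_[p]) ^ n * -w n a by
          linear_combination -h, mul_div_cancel_left₀ _ hq0]
      push_cast
      ring
    have h := congrArg (fun t : ℤ_[p] => (t : ℚ_[p])) (he n)
    push_cast [PadicInt.coe_sum] at h hxcoe
    rw [hxcoe] at h
    simp only [hEn, mul_add, Finset.sum_add_distrib]
    rw [← Finset.sum_mul, mul_comm (∑ a ∈ Finset.range (p ^ n), (a : ℚ_[p]) ^ (K - 1))]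
    congr 1
    push_cast [PadicInt.coe_sum]
    field_simp
    linear_combination -h
  · push_cast
    congr 1
    ring
end

section
/- Let c be a unit of ℤ_p. For every integer k ≥ 1, the sequence n ↦ Σ_{0 ≤ α < p^n, p ∤ α} α^{k−1}·(μ_{c,n}(α) + E_{1,c,n}(α)) converges in ℚ_p to (1 − c^k)·(B_k(i/m)/k − p^{k−1}·B_k(r_1/m)/k). (This is the measure-theoretic content of Theorem 3.7 i): the value of the p-adic Hurwitz-type L-function L^β(1−k, (ξ_m^{−i}) + ι(ξ_m^i); σ) at k ≡ β mod (p−1) equals B_k(i/m)/k − p^{k−1}·B_k(r_1/m)/k.) -/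
open Finset in
/-- `x ↦ ∑_{j < N} (j + x)^K` telescopes through Bernoulli polynomials. -/
theorem bernoulli_eval_add_natCast_sub (K N : ℕ) (x : ℚ) :
    (Polynomial.bernoulli (K + 1)).eval (x + N) - (Polynomial.bernoulli (K + 1)).eval x
      = (K + 1) * ∑ j ∈ range N, ((j : ℚ) + x) ^ K := by
  induction N with
  | zero => simp
  | succ N ih =>
    have h := Polynomial.bernoulli_eval_one_add (K + 1) (x + N)
    rw [sum_range_succ, mul_add, ← ih, Nat.cast_succ,
      show x + ((N : ℚ) + 1) = 1 + (x + N) by ring, h]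
    simp only [Nat.add_sub_cancel]
    push_cast
    ring

open Filter Topology Finset in
/-- The Volkenborn integral of `(t + x)^K` is `B_K(x)`. -/
theorem tendsto_sum_pow_div_bernoulli (p : ℕ) [Fact p.Prime] (K : ℕ) (x : ℚ) :
    Tendsto (fun n : ℕ => (∑ j ∈ range (p ^ n), ((j : ℚ_[p]) + (x : ℚ_[p])) ^ K) /
      (p : ℚ_[p]) ^ n) atTop (𝓝 (((Polynomial.bernoulli K).eval x : ℚ) : ℚ_[p])) := by
  have hev (P : Polynomial ℚ) (z : ℚ) :
      (P.map (algebraMap ℚ ℚ_[p])).eval (z : ℚ_[p]) = ((P.eval z : ℚ) : ℚ_[p]) := by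
    rw [Polynomial.eval_map, ← eq_ratCast (algebraMap ℚ ℚ_[p]) z, Polynomial.eval₂_at_apply,
      eq_ratCast]
  have hp0 : (p : ℚ_[p]) ≠ 0 := Nat.cast_ne_zero.mpr (Fact.out : p.Prime).ne_zero
  have hK : ((K : ℚ_[p]) + 1) ≠ 0 := by exact_mod_cast K.succ_ne_zero
  have hd := ((Polynomial.bernoulli (K + 1)).map (algebraMap ℚ ℚ_[p])).hasDerivAt (x : ℚ_[p])
  rw [Polynomial.derivative_map, Polynomial.derivative_bernoulli_add_one, hev,
    hasDerivAt_iff_tendsto_slope_zero] at hd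
  have hq : Tendsto (fun n : ℕ => (p : ℚ_[p]) ^ n) atTop (𝓝[≠] 0) :=
    tendsto_nhdsWithin_iff.mpr
      ⟨tendsto_pow_atTop_nhds_zero_of_norm_lt_one Padic.norm_p_lt_one,
        Eventually.of_forall fun n => pow_ne_zero n hp0⟩
  have h := (hd.comp hq).const_mul ((K : ℚ_[p]) + 1)⁻¹
  convert h using 2
  · rename_i n
    have hs := congrArg (fun z : ℚ => (z : ℚ_[p])) (bernoulli_eval_add_natCast_sub K (p ^ n) x)
    have e : (x : ℚ_[p]) + (p : ℚ_[p]) ^ n = ((x + (p ^ n : ℕ) : ℚ) : ℚ_[p]) := by push_cast; rfl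
    simp only [Function.comp_apply, smul_eq_mul]
    rw [e, hev, hev, ← Rat.cast_sub, hs]
    push_cast
    field_simp
  · simp only [Polynomial.eval_mul, Polynomial.eval_add, Polynomial.eval_natCast,
      Polynomial.eval_one]
    push_cast
    field_simp

theorem PadicInt.natCast_eq_of_pow_dvd_sub {p : ℕ} [Fact p.Prime] {n a b : ℕ}
    (ha : a < p ^ n) (hb : b < p ^ n) (h : (p : ℤ_[p]) ^ n ∣ (a : ℤ_[p]) - b) : a = b := by
  have h1 : ((p : ℤ) ^ n) ∣ (a : ℤ) - b := by
    rw [← PadicInt.pow_p_dvd_int_iff (p := p)]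
    push_cast
    exact h
  have h2 : (b : ℤ) ≡ a [ZMOD ((p ^ n : ℕ) : ℤ)] := by
    rw [Int.modEq_iff_dvd]
    exact_mod_cast h1
  exact (Nat.ModEq.eq_of_lt_of_lt ((Int.natCast_modEq_iff).mp h2) hb ha).symm

theorem PadicInt.p_dvd_natCast {p : ℕ} [Fact p.Prime] (a : ℕ) : (p : ℤ_[p]) ∣ a ↔ p ∣ a := by
  rw [← PadicInt.norm_lt_one_iff_dvd, PadicInt.norm_natCast_lt_one_iff]

/-- First-order expansion of `y ^ K` at scale `q`, with a remainder of size `‖q‖`. -/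
theorem norm_pow_mul_sub_le {p : ℕ} [Fact p.Prime] (K : ℕ) (q a y d μ : ℤ_[p]) (h : ℚ_[p])
    (hq : q ≠ 0) (hy : y = a + q * μ) :
    ‖(K : ℚ_[p]) * ((a : ℚ_[p]) ^ (K - 1) * (d + h)) -
      (((y : ℚ_[p]) ^ K - (y - q * d : ℚ_[p]) ^ K) / q + K * h * (y : ℚ_[p]) ^ (K - 1))‖
      ≤ ‖q‖ * (2 + ‖h‖) := by
  obtain ⟨u, hu⟩ : q ∣ a ^ (K - 1) - y ^ (K - 1) :=
    dvd_trans ⟨-μ, by rw [hy]; ring⟩ (sub_dvd_pow_sub_pow a y (K - 1))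
  obtain ⟨v, hv⟩ := Polynomial.powAddExpansion y (-(q * d)) K
  have hq' : (q : ℚ_[p]) ≠ 0 := fun h0 => hq (Subtype.ext h0)
  have hu' : (a : ℚ_[p]) ^ (K - 1) = (y : ℚ_[p]) ^ (K - 1) + q * u := by
    have := congrArg (fun z : ℤ_[p] => (z : ℚ_[p])) hu
    push_cast at this
    linear_combination this
  have hv' : (y - q * d : ℚ_[p]) ^ K =
      (y : ℚ_[p]) ^ K + K * (y : ℚ_[p]) ^ (K - 1) * (-(q * d)) + v * (-(q * d)) ^ 2 := by
    have := congrArg (fun z : ℤ_[p] => (z : ℚ_[p])) hv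
    push_cast at this
    rw [← this]
    ring
  have key : (K : ℚ_[p]) * ((a : ℚ_[p]) ^ (K - 1) * (d + h)) -
      (((y : ℚ_[p]) ^ K - (y - q * d : ℚ_[p]) ^ K) / q + K * h * (y : ℚ_[p]) ^ (K - 1))
      = q * (((K * u * d + v * d ^ 2 : ℤ_[p]) : ℚ_[p]) + ((K * u : ℤ_[p]) : ℚ_[p]) * h) := by
    rw [hu', hv']
    push_cast
    field_simp
    ring
  rw [key, norm_mul, PadicInt.padic_norm_e_of_padicInt]
  gcongr
  refine (norm_add_le _ _).trans ?_
  rw [norm_mul, PadicInt.padic_norm_e_of_padicInt, PadicInt.padic_norm_e_of_padicInt]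
  have h1 := PadicInt.norm_le_one ((K : ℤ_[p]) * u * d + v * d ^ 2)
  have h2 := PadicInt.norm_le_one ((K : ℤ_[p]) * u)
  nlinarith [norm_nonneg h]

open Finset in
/-- Multiplication by a unit permutes the residues prime to `p`. -/
theorem sum_comp_unit_mul {p : ℕ} [Fact p.Prime] {M : Type*} [AddCommMonoid M] (n : ℕ)
    (hn : n ≠ 0) (c : ℤ_[p]) (b : ℕ → ℕ)
    (hb : ∀ a, b a < p ^ n ∧ (p : ℤ_[p]) ^ n ∣ c * (b a : ℤ_[p]) - (a : ℤ_[p])) (f : ℕ → M) :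
    ∑ a ∈ range (p ^ n) with ¬ p ∣ a, f (b a) = ∑ a ∈ range (p ^ n) with ¬ p ∣ a, f a := by
  have hm : Set.MapsTo b ((range (p ^ n)).filter fun a => ¬ p ∣ a)
      ((range (p ^ n)).filter fun a => ¬ p ∣ a) := by
    intro a ha
    simp only [coe_filter, mem_range, Set.mem_ofPred_eq] at ha ⊢
    refine ⟨(hb a).1, fun hd => ha.2 ?_⟩
    rw [← PadicInt.p_dvd_natCast] at hd ⊢
    have := (dvd_pow_self (p : ℤ_[p]) hn).trans (hb a).2
    exact (dvd_sub_right (hd.mul_left c)).mp this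
  have hi : Set.InjOn b ((range (p ^ n)).filter fun a => ¬ p ∣ a) := by
    intro a ha a' ha' h
    simp only [coe_filter, mem_range, Set.mem_ofPred_eq] at ha ha'
    refine PadicInt.natCast_eq_of_pow_dvd_sub ha.1 ha'.1 ?_
    have := dvd_sub (hb a').2 (hb a).2
    rw [h] at this
    convert this using 1
    ring
  exact sum_nbij b hm hi (surjOn_of_injOn_of_card_le b hm hi le_rfl) fun _ _ => rfl

open Finset in
/-- Removing from `[0, p^(n+1))` the residue class of `s` modulo `p`. -/
theorem sum_filter_mod_ne {p : ℕ} {M : Type*} [AddCommGroup M] (n s : ℕ)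
    (hs : s < p) (f : ℕ → M) :
    ∑ a ∈ range (p ^ (n + 1)) with ¬ a % p = s, f a
      = ∑ a ∈ range (p ^ (n + 1)), f a - ∑ t ∈ range (p ^ n), f (s + p * t) := by
  have h := sum_filter_add_sum_filter_not (range (p ^ (n + 1))) (fun a => a % p = s) f
  rw [eq_sub_iff_add_eq, ← h, add_comm, add_left_inj]
  refine sum_bij' (fun t _ => s + p * t) (fun a _ => a / p) ?_ ?_ ?_ ?_ ?_
  · intro t ht
    simp only [mem_filter, mem_range] at ht ⊢
    refine ⟨?_, by rw [Nat.add_mul_mod_self_left, Nat.mod_eq_of_lt hs]⟩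
    calc s + p * t < p + p * t := by omega
      _ = p * (t + 1) := by ring
      _ ≤ p * p ^ n := Nat.mul_le_mul_left p ht
      _ = p ^ (n + 1) := by ring
  · intro a ha
    simp only [mem_filter, mem_range] at ha ⊢
    exact Nat.div_lt_of_lt_mul (by rw [← pow_succ']; exact ha.1)
  · intro t _
    rw [Nat.add_mul_div_left _ _ (by omega), Nat.div_eq_of_lt hs, zero_add]
  · intro a ha
    simp only [mem_filter] at ha
    have := Nat.mod_add_div a p
    rw [← ha.2]
    exact this
  · intros; rfl

open Finset in
/-- Translation by `S` modulo `p^n`, with the carry made explicit. -/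
theorem sum_translate_mod_pow {p : ℕ} [Fact p.Prime] {M : Type*} [AddCommMonoid M] (n S : ℕ)
    (hn : n ≠ 0) (hS : S < p ^ n) (f : ℕ → M) :
    ∑ a ∈ range (p ^ n) with ¬ p ∣ a, f (if p ^ n ≤ a + S then a + S - p ^ n else a + S)
      = ∑ a ∈ range (p ^ n) with ¬ a % p = S % p, f a := by
  obtain ⟨w, hw⟩ := dvd_pow_self p hn
  have hmod : ∀ a, a < p ^ n →
      ((if p ^ n ≤ a + S then a + S - p ^ n else a + S) % p = S % p ↔ p ∣ a) := by
    intro a ha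
    have h1 : (if p ^ n ≤ a + S then a + S - p ^ n else a + S) % p = (S + a) % p := by
      split_ifs with h
      · conv_rhs => rw [show S + a = a + S - p ^ n + p * w by omega, Nat.add_mul_mod_self_left]
      · rw [add_comm]
    rw [h1]
    constructor
    · intro h
      have : S + a ≡ S + 0 [MOD p] := h
      exact (Nat.modEq_zero_iff_dvd).mp (Nat.ModEq.add_left_cancel' S this)
    · rintro ⟨t, rfl⟩
      exact Nat.add_mul_mod_self_left S p t
  refine sum_bij' (fun a _ => if p ^ n ≤ a + S then a + S - p ^ n else a + S)
    (fun a _ => if S ≤ a then a - S else a + p ^ n - S) ?_ ?_ ?_ ?_ ?_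
  · intro a ha
    simp only [mem_filter, mem_range] at ha ⊢
    rw [hmod a ha.1]
    refine ⟨by split_ifs <;> omega, ha.2⟩
  · intro a ha
    simp only [mem_filter, mem_range] at ha ⊢
    have hlt : (if S ≤ a then a - S else a + p ^ n - S) < p ^ n := by split_ifs <;> omega
    refine ⟨hlt, ?_⟩
    rw [← hmod _ hlt]
    convert ha.2 using 3
    split_ifs <;> omega
  · intro a ha
    simp only [mem_filter, mem_range] at ha
    split_ifs <;> omega
  · intro a ha
    simp only [mem_filter, mem_range] at ha
    split_ifs <;> omega
  · intros; rfl

open Finset in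
/-- Riemann sums of `a^(K-1)` against the `c`-regularization of `μ + a / p^n - 1/2`. -/
theorem norm_riemann_sum_sub_le {p : ℕ} [Fact p.Prime] (n K : ℕ) (hn : n ≠ 0)
    (c : ℤ_[p]) (b : ℕ → ℕ)
    (hb : ∀ a, b a < p ^ n ∧ (p : ℤ_[p]) ^ n ∣ c * (b a : ℤ_[p]) - (a : ℤ_[p]))
    (μ : ℕ → ℤ_[p]) (y : ℕ → ℤ_[p]) (hy : ∀ a : ℕ, y a = a + (p : ℤ_[p]) ^ n * μ a)
    (F : ℕ → ℚ_[p])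
    (hF : ∀ a : ℕ, F a = (((μ a - c * μ (b a) : ℤ_[p])) : ℚ_[p]) +
      ((a : ℚ_[p]) / (p : ℚ_[p]) ^ n - (c : ℚ_[p]) * (b a : ℚ_[p]) / (p : ℚ_[p]) ^ n
        + ((c : ℚ_[p]) - 1) / 2)) :
    ‖(K : ℚ_[p]) * ∑ a ∈ range (p ^ n) with ¬ p ∣ a, (a : ℚ_[p]) ^ (K - 1) * F a -
      ((1 - (c : ℚ_[p]) ^ K) *
          ((∑ a ∈ range (p ^ n) with ¬ p ∣ a, (y a : ℚ_[p]) ^ K) / (p : ℚ_[p]) ^ n) +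
        K * (((c : ℚ_[p]) - 1) / 2) *
          ∑ a ∈ range (p ^ n) with ¬ p ∣ a, (y a : ℚ_[p]) ^ (K - 1))‖
      ≤ ‖(p : ℚ_[p]) ^ n‖ * (2 + ‖((c : ℚ_[p]) - 1) / 2‖) := by
  have hp0 : (p : ℚ_[p]) ≠ 0 := Nat.cast_ne_zero.mpr (Fact.out : p.Prime).ne_zero
  have hp0' : (p : ℤ_[p]) ≠ 0 := Nat.cast_ne_zero.mpr (Fact.out : p.Prime).ne_zero
  have hre := sum_comp_unit_mul n hn c b hb (fun a => (y a : ℚ_[p]) ^ K)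
  have hsplit : (1 - (c : ℚ_[p]) ^ K) *
      ((∑ a ∈ range (p ^ n) with ¬ p ∣ a, (y a : ℚ_[p]) ^ K) / (p : ℚ_[p]) ^ n) =
      ∑ a ∈ range (p ^ n) with ¬ p ∣ a,
        ((y a : ℚ_[p]) ^ K - ((c : ℚ_[p]) * y (b a)) ^ K) / (p : ℚ_[p]) ^ n := by
    rw [← sum_div, sum_sub_distrib]
    simp only [mul_pow]
    rw [← mul_sum, hre]
    ring
  rw [hsplit, mul_sum, mul_sum, ← sum_add_distrib, ← sum_sub_distrib]
  refine IsUltrametricDist.norm_sum_le_of_forall_le_of_nonneg (by positivity) fun a _ => ?_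
  obtain ⟨e, he⟩ := (hb a).2
  have he' := congrArg (fun z : ℤ_[p] => (z : ℚ_[p])) he
  push_cast at he'
  have hy' (a : ℕ) : (y a : ℚ_[p]) = a + (p : ℚ_[p]) ^ n * μ a := by
    rw [hy]; push_cast; rfl
  have h := norm_pow_mul_sub_le K ((p : ℤ_[p]) ^ n) (a : ℤ_[p]) (y a) (μ a - c * μ (b a) - e) (μ a)
    (((c : ℚ_[p]) - 1) / 2) (pow_ne_zero n hp0') (hy a)
  rw [← PadicInt.padic_norm_e_of_padicInt ((p : ℤ_[p]) ^ n)] at h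
  push_cast at h
  have e1 : F a = (μ a : ℚ_[p]) - c * μ (b a) - e + ((c : ℚ_[p]) - 1) / 2 := by
    rw [hF]
    push_cast
    field_simp
    linear_combination -2 * he'
  have e2 : (c : ℚ_[p]) * y (b a) =
      y a - (p : ℚ_[p]) ^ n * ((μ a : ℚ_[p]) - c * μ (b a) - e) := by
    rw [hy', hy']
    linear_combination he'
  rw [e1, e2]
  exact h

open Finset in
theorem sum_digits_mul_eq (p m : ℤ) (r k : ℕ → ℤ)
    (hk : ∀ n, m * k n = p * r (n + 1) - r n) (n : ℕ) :
    m * ∑ α ∈ range n, k α * p ^ α = p ^ n * r n - r 0 := by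
  induction n with
  | zero => simp
  | succ n ih =>
    rw [sum_range_succ, mul_add, ih]
    linear_combination p ^ n * hk n

open Finset in
theorem one_add_sum_complement_digits (p : ℤ) (k : ℕ → ℤ) (n : ℕ) :
    1 + ∑ α ∈ range n, (p - 1 - k α) * p ^ α = p ^ n - ∑ α ∈ range n, k α * p ^ α := by
  induction n with
  | zero => simp
  | succ n ih =>
    rw [sum_range_succ, sum_range_succ, ← add_assoc, ih]
    ring

open Finset in
/-- Sums over the points `a' + x` prime to `p`, where `m x = i` and
`a' ≡ a - x` modulo `p^(n+1)`. -/
theorem sum_translate_pow_eq {p : ℕ} [Fact p.Prime] (m i r₁ n S s j : ℕ) (hm : m ≠ 0)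
    (hS : S < p ^ (n + 1)) (hs : s < p) (hSs : S % p = s) (hr : m * s + i = p * r₁)
    (minv : ℤ_[p]) (hminv : (m : ℤ_[p]) * minv = 1) (y : ℕ → ℤ_[p])
    (hy : ∀ a : ℕ, y a = a + S + i * minv - if p ^ (n + 1) ≤ a + S then (p : ℤ_[p]) ^ (n + 1) else 0) :
    ∑ a ∈ range (p ^ (n + 1)) with ¬ p ∣ a, (y a : ℚ_[p]) ^ j =
      ∑ a ∈ range (p ^ (n + 1)), ((a : ℚ_[p]) + ((i / m : ℚ) : ℚ_[p])) ^ j -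
        (p : ℚ_[p]) ^ j *
          ∑ a ∈ range (p ^ n), ((a : ℚ_[p]) + ((r₁ / m : ℚ) : ℚ_[p])) ^ j := by
  have hm0 : (m : ℚ_[p]) ≠ 0 := Nat.cast_ne_zero.mpr hm
  have hinv : (minv : ℚ_[p]) = (m : ℚ_[p])⁻¹ := by
    refine eq_inv_of_mul_eq_one_right ?_
    exact_mod_cast congrArg (fun z : ℤ_[p] => (z : ℚ_[p])) hminv
  have hy' (a : ℕ) : (y a : ℚ_[p]) =
      ((if p ^ (n + 1) ≤ a + S then a + S - p ^ (n + 1) else a + S : ℕ) : ℚ_[p]) +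
        ((i / m : ℚ) : ℚ_[p]) := by
    rw [hy]
    split_ifs with h
    · push_cast [Nat.cast_sub h, hinv]
      ring
    · push_cast [hinv]
      ring
  have hr' : (m : ℚ_[p]) * s + i = p * r₁ := by exact_mod_cast hr
  simp only [hy']
  rw [sum_translate_mod_pow (n + 1) S n.succ_ne_zero hS
    (fun a : ℕ => ((a : ℚ_[p]) + ((i / m : ℚ) : ℚ_[p])) ^ j), hSs, sum_filter_mod_ne n s hs,
    mul_sum]
  congr 1
  refine sum_congr rfl fun t _ => ?_
  rw [← mul_pow]
  congr 1
  push_cast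
  field_simp
  linear_combination hr'


/-- Let `c` be a unit of `ℤ_p`. For every integer `k ≥ 1`, the sequence
`n ↦ Σ_{0 ≤ α < p^n, p ∤ α} α^{k−1}·(μ_{c,n}(α) + E_{1,c,n}(α))` converges in `ℚ_p`
to `(1 − c^k)·(B_k(i/m)/k − p^{k−1}·B_k(r_1/m)/k)`.  (Measure-theoretic content of
Theorem 3.7 i): the value of the p-adic Hurwitz-type L-function
`L^β(1−k, (ξ_m^{−i}) + ι(ξ_m^i); σ)` at `k ≡ β mod (p−1)` equals
`B_k(i/m)/k − p^{k−1}·B_k(r_1/m)/k`.) -/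
theorem stmt_17 (p : ℕ) [Fact p.Prime] (m i : ℕ) (hm : 1 < m) (hpm : ¬ p ∣ m)
    (hi : 0 < i) (him : i < m)
    (r : ℕ → ℕ) (hr : ∀ n : ℕ, r n < m ∧ (m : ℤ) ∣ (p : ℤ) ^ n * (r n : ℤ) - (i : ℤ))
    (k : ℕ → ℤ) (hk : ∀ n : ℕ, (m : ℤ) * k n = (p : ℤ) * (r (n + 1) : ℤ) - (r n : ℤ))
    (hk' : ∀ n : ℕ, 0 ≤ k n ∧ k n ≤ (p : ℤ) - 1)
    (minv : ℤ_[p]) (hminv : (m : ℤ_[p]) * minv = 1)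
    (T : ℕ → ℤ)
    (hT : ∀ n : ℕ, T n = 1 + ∑ α ∈ Finset.range n, ((p : ℤ) - 1 - k α) * (p : ℤ) ^ α)
    (δ : ℕ → ℕ → ℤ) (hδ : ∀ n a : ℕ, δ n a = if T n ≤ (a : ℤ) then -1 else 0)
    (μ : ℕ → ℕ → ℤ_[p])
    (hμ : ∀ n a : ℕ, μ n a = (r n : ℤ_[p]) * minv + (δ n a : ℤ_[p]))
    (c : ℤ_[p]ˣ)
    (b : ℕ → ℕ → ℕ)
    (hb : ∀ n a : ℕ, b n a < p ^ n ∧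
      (p : ℤ_[p]) ^ n ∣ (c : ℤ_[p]) * (b n a : ℤ_[p]) - (a : ℤ_[p]))
    (μc : ℕ → ℕ → ℤ_[p])
    (hμc : ∀ n a : ℕ, μc n a = μ n a - (c : ℤ_[p]) * μ n (b n a))
    (E : ℕ → ℕ → ℚ_[p])
    (hE : ∀ n a : ℕ, 1 ≤ n →
      E n a = (a : ℚ_[p]) / (p : ℚ_[p]) ^ n
        - ((c : ℤ_[p]) : ℚ_[p]) * (b n a : ℚ_[p]) / (p : ℚ_[p]) ^ n
        + (((c : ℤ_[p]) : ℚ_[p]) - 1) / 2) :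
    ∀ K : ℕ, 1 ≤ K →
      Filter.Tendsto
        (fun n : ℕ => ∑ α ∈ (Finset.range (p ^ n)).filter (fun α => ¬ p ∣ α),
          (α : ℚ_[p]) ^ (K - 1) * ((μc n α : ℚ_[p]) + E n α))
        Filter.atTop
        (nhds ((1 - ((c : ℤ_[p]) : ℚ_[p]) ^ K) *
          ((Polynomial.eval ((i : ℚ) / (m : ℚ)) (Polynomial.bernoulli K) / (K : ℚ)
            - (p : ℚ) ^ (K - 1) *
              Polynomial.eval ((r 1 : ℚ) / (m : ℚ)) (Polynomial.bernoulli K) / (K : ℚ)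
            : ℚ) : ℚ_[p]))) := by
  intro K hK
  have hp0 : (p : ℚ_[p]) ≠ 0 := Nat.cast_ne_zero.mpr (Fact.out : p.Prime).ne_zero
  have hK0 : (K : ℚ_[p]) ≠ 0 := Nat.cast_ne_zero.mpr (by omega)
  have hr0 : (r 0 : ℤ) = i := by
    obtain ⟨h1, h2⟩ := hr 0
    rw [pow_zero, one_mul] at h2
    have h3 : (i : ℤ) ≡ r 0 [ZMOD m] := Int.modEq_iff_dvd.mpr h2
    exact_mod_cast (Nat.ModEq.eq_of_lt_of_lt (Int.natCast_modEq_iff.mp h3) him h1).symm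
  -- the digits of `-i/m`
  have hdig := sum_digits_mul_eq (p : ℤ) m (fun n => (r n : ℤ)) k hk
  have hTS : ∀ n, T n = (p : ℤ) ^ n - ∑ α ∈ Finset.range n, k α * (p : ℤ) ^ α := fun n => by
    rw [hT, one_add_sum_complement_digits]
  have hS0 : ∀ n, 0 ≤ ∑ α ∈ Finset.range n, k α * (p : ℤ) ^ α := fun n =>
    Finset.sum_nonneg fun α _ => mul_nonneg (hk' α).1 (by positivity)
  choose S hS using fun n => Int.eq_ofNat_of_zero_le (hS0 n)
  have hSlt : ∀ n, S n < p ^ n := fun n => by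
    have h1 : 1 ≤ T n := by
      rw [hT]
      have : 0 ≤ ∑ α ∈ Finset.range n, ((p : ℤ) - 1 - k α) * (p : ℤ) ^ α :=
        Finset.sum_nonneg fun α _ => mul_nonneg (by linarith [(hk' α).2]) (by positivity)
      linarith
    rw [hTS, hS] at h1
    have : (S n : ℤ) < (p : ℤ) ^ n := by linarith
    exact_mod_cast this
  obtain ⟨s, hs⟩ := Int.eq_ofNat_of_zero_le (hk' 0).1
  have hsp : s < p := by
    have := (hk' 0).2
    omega
  have hSs : ∀ n, S (n + 1) % p = s := fun n => by
    have h1 := hS (n + 1)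
    rw [Finset.sum_range_succ'] at h1
    simp only [pow_succ, ← mul_assoc, ← Finset.sum_mul, pow_zero, mul_one, hs] at h1
    have h2 : (s : ℤ) ≡ S (n + 1) [ZMOD p] := by
      rw [Int.modEq_iff_dvd, ← h1]
      exact ⟨_, by rw [add_sub_cancel_right, mul_comm]⟩
    have h3 : S (n + 1) % p = s % p := (Int.natCast_modEq_iff.mp h2).symm
    rw [h3, Nat.mod_eq_of_lt hsp]
  have hr1 : m * s + i = p * r 1 := by
    have h1 := hk 0
    rw [hr0, hs] at h1
    zify
    linarith
  have hy : ∀ n a : ℕ, (a : ℤ_[p]) + (p : ℤ_[p]) ^ n * μ n a =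
      a + S n + i * minv - if p ^ n ≤ a + S n then (p : ℤ_[p]) ^ n else 0 := by
    intro n a
    have h1 : (m : ℤ_[p]) * S n = (p : ℤ_[p]) ^ n * r n - i := by
      have := hdig n
      rw [hS, hr0] at this
      exact_mod_cast congrArg (fun z : ℤ => (z : ℤ_[p])) this
    have h2 : T n ≤ (a : ℤ) ↔ p ^ n ≤ a + S n := by
      rw [hTS, hS]
      zify
      constructor <;> intro h <;> linarith
    rw [hμ, hδ]
    simp only [h2]
    split_ifs
    · push_cast
      linear_combination (-minv) * h1 + (S n : ℤ_[p]) * hminv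
    · push_cast
      linear_combination (-minv) * h1 + (S n : ℤ_[p]) * hminv
  -- power sums over the points prime to `p`
  set U : ℕ → ℕ → ℚ_[p] := fun j n => ∑ a ∈ (Finset.range (p ^ n)).filter (fun a => ¬ p ∣ a),
    (((a : ℤ_[p]) + (p : ℤ_[p]) ^ n * μ n a : ℤ_[p]) : ℚ_[p]) ^ j with hU
  have hUeq (j n : ℕ) := sum_translate_pow_eq m i (r 1) n (S (n + 1)) s j (by omega)
    (hSlt (n + 1)) hsp (hSs n) hr1 minv hminv _ (hy (n + 1))
  set L : ℕ → ℚ_[p] := fun j =>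
    ((Polynomial.eval ((i : ℚ) / (m : ℚ)) (Polynomial.bernoulli j) : ℚ) : ℚ_[p]) -
      (p : ℚ_[p]) ^ j / p *
        ((Polynomial.eval ((r 1 : ℚ) / (m : ℚ)) (Polynomial.bernoulli j) : ℚ) : ℚ_[p]) with hL
  have hlim (j : ℕ) : Filter.Tendsto (fun n => U j (n + 1) / (p : ℚ_[p]) ^ (n + 1))
      Filter.atTop (nhds (L j)) := by
    have h1 := (Filter.tendsto_add_atTop_iff_nat 1).mpr
      (tendsto_sum_pow_div_bernoulli p j ((i : ℚ) / m))
    have h2 := (tendsto_sum_pow_div_bernoulli p j ((r 1 : ℚ) / m)).const_mul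
      ((p : ℚ_[p]) ^ j / p)
    refine (h1.sub h2).congr fun n => ?_
    simp only [hU]
    rw [hUeq]
    field_simp
    ring
  have hq0 : Filter.Tendsto (fun n : ℕ => (p : ℚ_[p]) ^ (n + 1)) Filter.atTop (nhds 0) :=
    (Filter.tendsto_add_atTop_iff_nat 1).mpr
      (tendsto_pow_atTop_nhds_zero_of_norm_lt_one Padic.norm_p_lt_one)
  have hlim0 (j : ℕ) : Filter.Tendsto (fun n => U j (n + 1)) Filter.atTop (nhds 0) := by
    have := (hlim j).mul hq0
    rw [mul_zero] at this
    refine this.congr fun n => ?_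
    field_simp
  have hmain : Filter.Tendsto (fun n : ℕ =>
      (1 - ((c : ℤ_[p]) : ℚ_[p]) ^ K) * (U K (n + 1) / (p : ℚ_[p]) ^ (n + 1)) +
        K * ((((c : ℤ_[p]) : ℚ_[p]) - 1) / 2) * U (K - 1) (n + 1))
      Filter.atTop (nhds ((1 - ((c : ℤ_[p]) : ℚ_[p]) ^ K) * L K)) := by
    have := ((hlim K).const_mul (1 - ((c : ℤ_[p]) : ℚ_[p]) ^ K)).add
      ((hlim0 (K - 1)).const_mul (K * ((((c : ℤ_[p]) : ℚ_[p]) - 1) / 2)))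
    rwa [mul_zero, add_zero] at this
  have herr := squeeze_zero_norm (fun n : ℕ => norm_riemann_sum_sub_le (n + 1) K n.succ_ne_zero
    (c : ℤ_[p]) (b (n + 1)) (hb (n + 1)) (μ (n + 1)) _ (fun _ => rfl)
    (fun a => (μc (n + 1) a : ℚ_[p]) + E (n + 1) a)
    (fun a => by rw [hμc, hE _ _ (Nat.le_add_left 1 n)]))
    (by simpa using hq0.norm.mul_const (2 + ‖(((c : ℤ_[p]) : ℚ_[p]) - 1) / 2‖))
  have hfin := (herr.add hmain).const_mul (K : ℚ_[p])⁻¹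
  rw [← Filter.tendsto_add_atTop_iff_nat 1]
  convert hfin using 2
  · rw [hU]
    rw [sub_add_cancel, inv_mul_cancel_left₀ hK0]
  · obtain ⟨K, rfl⟩ := Nat.exists_eq_add_of_le' hK
    simp only [hL, Nat.add_sub_cancel]
    push_cast at hK0 ⊢
    field_simp
    ring
end
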